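/- arXiv:2009.12593 — 2 statements merged into one kernel-verified Lean document; each statement's English description precedes it below -/
import Mathlib

section
/- For every integer n ≥ 9, the Turán number ex₃(n;𝒫₄) equals C(n−1,2)+1, and the starplus Sₙ^{+1} is the unique (up to isomorphism) 𝒫₄-free 3-graph on n vertices with C(n−1,2)+1 edges. -/
open Finset

/-- `H` is a 3-graph on the vertex set `V`: every edge is a 3-element subset of `V`. -/
def ThreeGraphOn (V : Finset ℕ) (H : Finset (Finset ℕ)) : Prop :=
  ∀ e ∈ H, e ⊆ V ∧ e.card = 3

/-- Four edges form a 3-uniform minimal 4-path: `aᵢ ∩ aⱼ ≠ ∅ ↔ |i - j| ≤ 1`. -/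
def IsMinPath4 (a₀ a₁ a₂ a₃ : Finset ℕ) : Prop :=
  (a₀ ∩ a₁).Nonempty ∧ (a₁ ∩ a₂).Nonempty ∧ (a₂ ∩ a₃).Nonempty ∧
    a₀ ∩ a₂ = ∅ ∧ a₀ ∩ a₃ = ∅ ∧ a₁ ∩ a₃ = ∅

/-- `H` contains no minimal 4-path. -/
def P4Free (H : Finset (Finset ℕ)) : Prop :=
  ¬∃ a₀ ∈ H, ∃ a₁ ∈ H, ∃ a₂ ∈ H, ∃ a₃ ∈ H, IsMinPath4 a₀ a₁ a₂ a₃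

/-- `H` is a starplus on `V`: a full star with center `v` together with one
extra 3-edge not containing `v`. -/
def IsStarPlusOn (V : Finset ℕ) (H : Finset (Finset ℕ)) : Prop :=
  ∃ v ∈ V, ∃ e : Finset ℕ, e ⊆ V ∧ e.card = 3 ∧ v ∉ e ∧
    H = (V.powersetCard 3).filter (fun t => v ∈ t) ∪ {e}


lemma P4Free.false {H : Finset (Finset ℕ)} (h : P4Free H) {a b c d : Finset ℕ}
    (ha : a ∈ H) (hb : b ∈ H) (hc : c ∈ H) (hd : d ∈ H)
    (hab : (a ∩ b).Nonempty) (hbc : (b ∩ c).Nonempty) (hcd : (c ∩ d).Nonempty)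
    (hac : Disjoint a c) (had : Disjoint a d) (hbd : Disjoint b d) : False :=
  h ⟨a, ha, b, hb, c, hc, d, hd, hab, hbc, hcd, disjoint_iff_inter_eq_empty.1 hac,
    disjoint_iff_inter_eq_empty.1 had, disjoint_iff_inter_eq_empty.1 hbd⟩

lemma not_disj {a b : Finset ℕ} (h : ¬ Disjoint a b) : (a ∩ b).Nonempty := by
  rwa [Finset.not_disjoint_iff_nonempty_inter] at h

structure Cfg (V : Finset ℕ) (H A B C : Finset (Finset ℕ)) : Prop where
  hV : ThreeGraphOn V H
  free : P4Free H
  hA : A ⊆ H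
  hB : B ⊆ H
  hC : C ⊆ H
  nA : A.Nonempty
  nB : B.Nonempty
  cover : ∀ e ∈ H, e ∈ A ∨ e ∈ B ∨ e ∈ C
  AB : ∀ a ∈ A, ∀ b ∈ B, Disjoint a b
  CA : ∀ c ∈ C, ∀ a ∈ A, (c ∩ a).Nonempty
  CB : ∀ c ∈ C, ∀ b ∈ B, (c ∩ b).Nonempty

lemma Cfg.symm {V : Finset ℕ} {H A B C : Finset (Finset ℕ)} (h : Cfg V H A B C) :
    Cfg V H B A C where
  hV := h.hV
  free := h.free
  hA := h.hB
  hB := h.hA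
  hC := h.hC
  nA := h.nB
  nB := h.nA
  cover := fun e he => by have := h.cover e he; tauto
  AB := fun a ha b hb => (h.AB b hb a ha).symm
  CA := h.CB
  CB := h.CA

lemma exists_cfg {V : Finset ℕ} {H : Finset (Finset ℕ)} (hV : ThreeGraphOn V H) (free : P4Free H)
    (hd : ∃ a ∈ H, ∃ b ∈ H, Disjoint a b) : ∃ A B C, Cfg V H A B C := by
  classical
  obtain ⟨a, ha, b, hb, hab⟩ := hd
  let S : Finset (Finset (Finset ℕ) × Finset (Finset ℕ)) :=
    (H.powerset ×ˢ H.powerset).filter (fun p => p.1.Nonempty ∧ p.2.Nonempty ∧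
      ∀ a ∈ p.1, ∀ b ∈ p.2, Disjoint a b)
  have hS : S.Nonempty := ⟨({a}, {b}), by simp [S, ha, hb, hab]⟩
  obtain ⟨⟨A, B⟩, hAB, hmax⟩ := Finset.exists_max_image S (fun p => p.1.card + p.2.card) hS
  simp only [S, mem_filter, mem_product, mem_powerset] at hAB hmax
  obtain ⟨⟨hA, hB⟩, nA, nB, dAB⟩ := hAB
  have ne3 : ∀ e ∈ H, e.Nonempty := fun e he => by
    rw [← card_pos, (hV e he).2]; norm_num
  have key : ∀ (A B : Finset (Finset ℕ)), A ⊆ H → B ⊆ H → A.Nonempty → B.Nonempty →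
      (∀ a ∈ A, ∀ b ∈ B, Disjoint a b) →
      (∀ A' B' : Finset (Finset ℕ), A' ⊆ H → B' ⊆ H → A'.Nonempty → B'.Nonempty →
        (∀ a ∈ A', ∀ b ∈ B', Disjoint a b) → A'.card + B'.card ≤ A.card + B.card) →
      ∀ c ∈ H, c ∉ A → c ∉ B → ∀ a ∈ A, (c ∩ a).Nonempty := by
    intro A B hA hB nA nB dAB hmax c hc cA cB a ha
    by_contra hca
    have hca' : Disjoint c a := by by_contra h; exact hca (not_disj h)
    by_cases hallA : ∀ a ∈ A, Disjoint c a
    · have := hmax A (insert c B) hA (insert_subset hc hB) nA (by simp) (by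
        intro x hx y hy
        rcases mem_insert.1 hy with rfl | hy
        · exact (hallA x hx).symm
        · exact dAB x hx y hy)
      rw [card_insert_of_notMem cB] at this; omega
    by_cases hallB : ∀ b ∈ B, Disjoint c b
    · have := hmax (insert c A) B (insert_subset hc hA) hB (by simp) nB (by
        intro x hx y hy
        rcases mem_insert.1 hx with rfl | hx
        · exact hallB y hy
        · exact dAB x hx y hy)
      rw [card_insert_of_notMem cA] at this; omega
    push Not at hallA hallB
    obtain ⟨a₁, ha₁, hca₁⟩ := hallA
    obtain ⟨b₁, hb₁, hcb₁⟩ := hallB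
    have hsplit : ∀ x ∈ A, ∀ y ∈ A, Disjoint c x → ¬ Disjoint c y → Disjoint x y := by
      intro x hx y hy hcx hcy
      by_contra hxy
      exact free.false (hA hx) (hA hy) hc (hB hb₁) (not_disj hxy)
        (not_disj fun h => hcy h.symm) (not_disj hcb₁) hcx.symm (dAB x hx b₁ hb₁) (dAB y hy b₁ hb₁)
    have := hmax (A.filter (fun x => Disjoint c x))
      (insert c (A.filter (fun x => ¬ Disjoint c x) ∪ B))
      ((filter_subset _ _).trans hA)
      (insert_subset hc (union_subset ((filter_subset _ _).trans hA) hB))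
      ⟨a, by simp [ha, hca']⟩ (by simp) (by
        intro x hx y hy
        simp only [mem_filter] at hx
        rcases mem_insert.1 hy with rfl | hy
        · exact hx.2.symm
        rcases mem_union.1 hy with hy | hy
        · simp only [mem_filter] at hy
          exact hsplit x hx.1 y hy.1 hx.2 hy.2
        · exact dAB x hx.1 y hy)
    rw [card_insert_of_notMem (by simp [cA, cB]), card_union_of_disjoint (by
      rw [Finset.disjoint_left]
      intro x hx hxB
      have hxA := (mem_filter.1 hx).1
      have h1 := dAB x hxA x hxB
      rw [disjoint_self_iff_empty] at h1
      exact (ne3 x (hA hxA)).ne_empty h1)] at this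
    have h2 := Finset.card_filter_add_card_filter_not (s := A) (fun x => Disjoint c x)
    omega
  have hmax' : ∀ A' B' : Finset (Finset ℕ), A' ⊆ H → B' ⊆ H → A'.Nonempty → B'.Nonempty →
        (∀ a ∈ A', ∀ b ∈ B', Disjoint a b) → A'.card + B'.card ≤ A.card + B.card := by
    intro A' B' h1 h2 h3 h4 h5
    exact hmax (A', B') ⟨⟨h1, h2⟩, h3, h4, h5⟩
  refine ⟨A, B, H \ (A ∪ B), hV, free, hA, hB, sdiff_subset, nA, nB, ?_, dAB, ?_, ?_⟩
  · intro e he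
    by_cases h1 : e ∈ A
    · simp [h1]
    by_cases h2 : e ∈ B
    · simp [h2]
    · simp [h1, h2, he]
  · intro c hc a ha
    simp only [mem_sdiff, mem_union, not_or] at hc
    exact key A B hA hB nA nB dAB hmax' c hc.1 hc.2.1 hc.2.2 a ha
  · intro c hc b hb
    simp only [mem_sdiff, mem_union, not_or] at hc
    exact key B A hB hA nB nA (fun x hx y hy => (dAB y hy x hx).symm)
      (fun A' B' h1 h2 h3 h4 h5 => by
        have := hmax' B' A' h2 h1 h4 h3 (fun x hx y hy => (h5 y hy x hx).symm)
        omega) c hc.1 hc.2.2 hc.2.1 b hb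

lemma intersecting_bound {V : Finset ℕ} {H : Finset (Finset ℕ)} {n : ℕ} (hn : 9 ≤ n)
    (hc : V.card = n) (hV : ThreeGraphOn V H)
    (hd : ¬ ∃ a ∈ H, ∃ b ∈ H, Disjoint a b) : H.card ≤ (n - 1).choose 2 := by
  classical
  let φ := V.orderEmbOfFin hc
  let f : Finset ℕ → Finset (Fin n) := fun e => univ.filter (fun i => φ i ∈ e)
  have hf : ∀ e ∈ H, (f e).map φ.toEmbedding = e := by
    intro e he
    ext x
    simp only [mem_map, f, mem_filter, mem_univ, true_and]
    constructor
    · rintro ⟨i, hi, rfl⟩; exact hi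
    · intro hx
      have : x ∈ Set.range φ := by
        rw [Finset.range_orderEmbOfFin]; exact (hV e he).1 hx
      obtain ⟨i, rfl⟩ := this
      exact ⟨i, hx, rfl⟩
  have hinj : Set.InjOn f H := by
    intro e he e' he' h
    rw [← hf e he, ← hf e' he', h]
  rw [← Finset.card_image_of_injOn hinj]
  refine Finset.erdos_ko_rado (r := 3) ?_ ?_ (by omega)
  · intro x hx y hy hxy
    simp only [coe_image, Set.mem_image, mem_coe] at hx hy
    obtain ⟨e, he, rfl⟩ := hx
    obtain ⟨e', he', rfl⟩ := hy
    apply hd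
    refine ⟨e, he, e', he', ?_⟩
    rw [← hf e he, ← hf e' he', Finset.disjoint_map]
    exact hxy
  · intro x hx
    simp only [coe_image, Set.mem_image, mem_coe] at hx
    obtain ⟨e, he, rfl⟩ := hx
    rw [← Finset.card_map φ.toEmbedding, hf e he, (hV e he).2]

/-- Pair lemma, strong form. -/
lemma pair_strong {H : Finset (Finset ℕ)} (free : P4Free H) {P Q M : Finset ℕ}
    (nP : P.Nonempty) (nQ : Q.Nonempty) (hPQ : Disjoint P Q) (hPM : Disjoint P M)
    (hQM : Disjoint Q M) :
    (M.filter (fun s => insert s P ∈ H)).card + (M.filter (fun s => insert s Q ∈ H)).card ≤ M.card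
    ∨ ((M.filter (fun s => insert s P ∈ H)).card ≤ 1)
    ∨ ((M.filter (fun s => insert s Q ∈ H)).card ≤ 1)
    ∨ ((M.filter (fun s => insert s P ∈ H)).card ≤ 2 ∧
      (M.filter (fun s => insert s Q ∈ H)).card ≤ 2) := by
  classical
  set X := M.filter (fun s => insert s P ∈ H) with hX
  set Y := M.filter (fun s => insert s Q ∈ H) with hY
  have path : ∀ i ∈ X, ∀ j ∈ X, j ∈ Y → ∀ k ∈ Y, i ≠ j → k ≠ j → i = k := by
    intro i hi j hj hj' k hk hij hkj
    by_contra hik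
    simp only [hX, hY, mem_filter] at hi hj hj' hk
    have dP : ∀ s ∈ M, s ∉ P := fun s hs h => (Finset.disjoint_left.1 hPM h) hs
    have dQ : ∀ s ∈ M, s ∉ Q := fun s hs h => (Finset.disjoint_left.1 hQM h) hs
    have D : ∀ s ∈ M, ∀ t ∈ M, s ≠ t → Disjoint (insert s P) (insert t Q) := by
      intro s hs t ht hst
      rw [disjoint_insert_left, disjoint_insert_right]
      exact ⟨by simp [hst, dQ s hs], dP t ht, hPQ⟩
    obtain ⟨p, hp⟩ := nP
    obtain ⟨q, hq⟩ := nQ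
    exact free.false hi.2 hj.2 hj'.2 hk.2 ⟨p, by simp [hp]⟩ ⟨j, by simp⟩ ⟨q, by simp [hq]⟩
      (D i hi.1 j hj.1 hij) (D i hi.1 k hk.1 hik) (D j hj.1 k hk.1 (Ne.symm hkj))
  by_cases hd : Disjoint X Y
  · left
    rw [← card_union_of_disjoint hd]
    exact card_le_card (union_subset (filter_subset _ _) (filter_subset _ _))
  right
  obtain ⟨j, hj⟩ := not_disj hd
  rw [mem_inter] at hj
  by_cases h1 : X.card ≤ 1
  · exact Or.inl h1
  by_cases h2 : Y.card ≤ 1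
  · exact Or.inr (Or.inl h2)
  right; right
  obtain ⟨i, hi, hij⟩ := Finset.exists_mem_ne (by omega : 1 < X.card) j
  obtain ⟨k, hk, hkj⟩ := Finset.exists_mem_ne (by omega : 1 < Y.card) j
  have hX2 : X ⊆ {j, k} := by
    intro x hx
    by_cases hxj : x = j
    · simp [hxj]
    · simp [path x hx j hj.1 hj.2 k hk hxj hkj]
  have hY2 : Y ⊆ {j, i} := by
    intro x hx
    by_cases hxj : x = j
    · simp [hxj]
    · simp [← path i hi j hj.1 hj.2 x hx hij hxj]
  exact ⟨(card_le_card hX2).trans card_le_two, (card_le_card hY2).trans card_le_two⟩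

lemma pair_lemma {H : Finset (Finset ℕ)} (free : P4Free H) {P Q M : Finset ℕ}
    (nP : P.Nonempty) (nQ : Q.Nonempty) (hPQ : Disjoint P Q) (hPM : Disjoint P M)
    (hQM : Disjoint Q M) (hM : 3 ≤ M.card) :
    (M.filter (fun s => insert s P ∈ H)).card + (M.filter (fun s => insert s Q ∈ H)).card
      ≤ M.card + 1 := by
  have h1 := card_filter_le M (fun s => insert s P ∈ H)
  have h2 := card_filter_le M (fun s => insert s Q ∈ H)
  have := pair_strong free nP nQ hPQ hPM hQM
  omega


/-- Union of a family. -/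
def US (A : Finset (Finset ℕ)) : Finset ℕ := A.biUnion id

/-- Common vertices. -/
def core (A : Finset (Finset ℕ)) : Finset ℕ := (US A).filter (fun v => ∀ a ∈ A, v ∈ a)

/-- 2-covers avoiding the core. -/
def cov (A : Finset (Finset ℕ)) : Finset (Finset ℕ) :=
  ((US A \ core A).powersetCard 2).filter (fun K => ∀ a ∈ A, (K ∩ a).Nonempty)

lemma sub_US {A : Finset (Finset ℕ)} {a : Finset ℕ} (ha : a ∈ A) : a ⊆ US A :=
  fun x hx => mem_biUnion.2 ⟨a, ha, hx⟩

lemma mem_core {A : Finset (Finset ℕ)} (nA : A.Nonempty) {v : ℕ} :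
    v ∈ core A ↔ ∀ a ∈ A, v ∈ a := by
  simp only [core, mem_filter, and_iff_right_iff_imp]
  intro h
  obtain ⟨a, ha⟩ := nA
  exact sub_US ha (h a ha)

lemma core_sub_US {A : Finset (Finset ℕ)} : core A ⊆ US A := filter_subset _ _

lemma core_sub {A : Finset (Finset ℕ)} {a : Finset ℕ} (ha : a ∈ A) : core A ⊆ a :=
  fun _ hx => (mem_filter.1 hx).2 a ha

lemma mem_cov {A : Finset (Finset ℕ)} {K : Finset ℕ} : K ∈ cov A ↔
    (K ⊆ US A \ core A ∧ K.card = 2) ∧ ∀ a ∈ A, (K ∩ a).Nonempty := by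
  simp [cov, mem_powersetCard]

lemma cov_not_core {A : Finset (Finset ℕ)} {K : Finset ℕ} (hK : K ∈ cov A) {v : ℕ} (hv : v ∈ K) :
    v ∉ core A := (mem_sdiff.1 ((mem_cov.1 hK).1.1 hv)).2

lemma cov_hit {A : Finset (Finset ℕ)} {K : Finset ℕ} (hK : K ∈ cov A) {a : Finset ℕ} (ha : a ∈ A) :
    ∃ v ∈ K, v ∈ a := by
  obtain ⟨v, hv⟩ := (mem_cov.1 hK).2 a ha
  exact ⟨v, (mem_inter.1 hv).1, (mem_inter.1 hv).2⟩

/-- A 2-set containing x is {x,k}. -/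
lemma two_eq {K : Finset ℕ} (h : K.card = 2) {x y : ℕ} (hx : x ∈ K) (hy : y ∈ K) (hxy : x ≠ y) :
    K = {x, y} := by
  symm
  apply eq_of_subset_of_card_le
  · intro z hz
    simp only [mem_insert, mem_singleton] at hz
    rcases hz with rfl | rfl <;> assumption
  · rw [h, card_pair hxy]

lemma three_eq {K : Finset ℕ} (h : K.card = 3) {x y z : ℕ} (hx : x ∈ K) (hy : y ∈ K) (hz : z ∈ K)
    (hxy : x ≠ y) (hxz : x ≠ z) (hyz : y ≠ z) : K = {x, y, z} := by
  symm
  apply eq_of_subset_of_card_le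
  · intro w hw
    simp only [mem_insert, mem_singleton] at hw
    rcases hw with rfl | rfl | rfl <;> assumption
  · rw [h, card_eq_three.2 ⟨x, y, z, hxy, hxz, hyz, rfl⟩]

/-- A 3-set containing a 2-set P. -/
lemma three_insert {K P : Finset ℕ} (h : K.card = 3) (hP : P.card = 2) (hPK : P ⊆ K) :
    ∃ s, s ∉ P ∧ s ∈ K ∧ K = insert s P := by
  have : (K \ P).card = 1 := by rw [card_sdiff_of_subset hPK]; omega
  obtain ⟨s, hs⟩ := card_eq_one.1 this
  have h1 : s ∈ K \ P := by rw [hs]; simp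
  rw [mem_sdiff] at h1
  refine ⟨s, h1.2, h1.1, ?_⟩
  rw [insert_eq, ← hs, sdiff_union_of_subset hPK]

lemma eq_of_card_eq_three {a b : Finset ℕ} (ha : a.card = 3) (hb : b.card = 3) (h : a ⊆ b) :
    a = b := eq_of_subset_of_card_le h (by omega)

section Fam

variable {A : Finset (Finset ℕ)}

lemma core_card_le (nA : A.Nonempty) (h3 : ∀ a ∈ A, a.card = 3) : (core A).card ≤ 3 := by
  obtain ⟨a, ha⟩ := nA
  rw [← h3 a ha]
  exact card_le_card (core_sub ha)

lemma US_card_ge (nA : A.Nonempty) (h3 : ∀ a ∈ A, a.card = 3) : 3 ≤ (US A).card := by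
  obtain ⟨a, ha⟩ := nA
  rw [← h3 a ha]
  exact card_le_card (sub_US ha)

lemma US_card_ge4 (nA : A.Nonempty) (h3 : ∀ a ∈ A, a.card = 3) (hc : (core A).card < 3) :
    4 ≤ (US A).card := by
  by_contra h
  have h4 := US_card_ge nA h3
  have : US A ⊆ core A := by
    intro v hv
    rw [mem_core nA]
    intro a ha
    have : a = US A := eq_of_subset_of_card_le (sub_US ha) (by rw [h3 a ha]; omega)
    rw [this]; exact hv
  have := card_le_card this
  omega

lemma card_le_choose (h3 : ∀ a ∈ A, a.card = 3) : A.card ≤ (US A).card.choose 3 := by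
  rw [← card_powersetCard]
  apply card_le_card
  intro a ha
  exact mem_powersetCard.2 ⟨sub_US ha, h3 a ha⟩

lemma core3 (nA : A.Nonempty) (h3 : ∀ a ∈ A, a.card = 3) (hc : (core A).card = 3) :
    A = {core A} ∧ US A = core A ∧ cov A = ∅ := by
  have h1 : ∀ a ∈ A, a = core A := fun a ha =>
    (eq_of_card_eq_three hc (h3 a ha) (core_sub ha)).symm
  have h2 : A = {core A} := by
    obtain ⟨a, ha⟩ := nA
    ext b
    rw [mem_singleton]
    constructor
    · exact h1 b
    · rintro rfl
      rw [← h1 a ha]; exact ha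
  have h4 : US A = core A := by
    conv_lhs => rw [h2]
    simp [US]
  refine ⟨h2, h4, ?_⟩
  rw [eq_empty_iff_forall_notMem]
  intro K hK
  have := (mem_cov.1 hK).1
  rw [h4] at this
  have h5 : K = ∅ := by simpa using this.1
  rw [h5] at this
  simp at this

lemma core2_card (h3 : ∀ a ∈ A, a.card = 3) (hc : (core A).card = 2) :
    A.card ≤ (US A).card - 2 := by
  have : A ⊆ (US A \ core A).image (fun s => insert s (core A)) := by
    intro a ha
    obtain ⟨s, hs, hsa, he⟩ := three_insert (h3 a ha) hc (core_sub ha)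
    rw [mem_image]
    exact ⟨s, mem_sdiff.2 ⟨sub_US ha hsa, hs⟩, he.symm⟩
  refine (card_le_card this).trans (card_image_le.trans ?_)
  rw [card_sdiff_of_subset core_sub_US, hc]

lemma core2_cov (nA : A.Nonempty) (h3 : ∀ a ∈ A, a.card = 3) (hc : (core A).card = 2) :
    (cov A).card ≤ 1 ∧ ((cov A).Nonempty → A.card ≤ 2) := by
  have hs : ∀ a ∈ A, ∃ s, s ∉ core A ∧ a = insert s (core A) := by
    intro a ha
    obtain ⟨s, hs, _, he⟩ := three_insert (h3 a ha) hc (core_sub ha)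
    exact ⟨s, hs, he⟩
  have hK : ∀ K ∈ cov A, ∀ s, insert s (core A) ∈ A → s ∈ K := by
    intro K hK s hsA
    obtain ⟨v, hv, hva⟩ := cov_hit hK hsA
    rcases mem_insert.1 hva with rfl | h
    · exact hv
    · exact absurd h (cov_not_core hK hv)
  -- two different edges
  obtain ⟨a, ha⟩ := nA
  obtain ⟨s, hsc, rfl⟩ := hs a ha
  have : ∃ t, t ≠ s ∧ insert t (core A) ∈ A := by
    by_contra hcon
    push Not at hcon
    have : s ∈ core A := by
      rw [mem_core ⟨_, ha⟩]
      intro b hb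
      obtain ⟨t, _, rfl⟩ := hs b hb
      by_cases hts : t = s
      · simp [hts]
      · exact absurd hb (hcon t hts)
    exact hsc this
  obtain ⟨t, hts, ht⟩ := this
  have hKe : ∀ K ∈ cov A, K = {s, t} := fun K h =>
    two_eq (mem_cov.1 h).1.2 (hK K h s ha) (hK K h t ht) (Ne.symm hts)
  constructor
  · apply card_le_one.2
    intro K h K' h'
    rw [hKe K h, hKe K' h']
  · rintro ⟨K, h⟩
    have : A ⊆ {insert s (core A), insert t (core A)} := by
      intro b hb
      obtain ⟨r, _, rfl⟩ := hs b hb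
      have := hK K h r hb
      rw [hKe K h] at this
      simp only [mem_insert, mem_singleton] at this ⊢
      rcases this with rfl | rfl <;> simp
    exact (card_le_card this).trans card_le_two

/-- Degree bound in the cover graph. -/
lemma cov_deg (nA : A.Nonempty) (h3 : ∀ a ∈ A, a.card = 3) {x : ℕ} (hx : x ∉ core A) :
    ((cov A).filter (fun K => x ∈ K)).card ≤ 3 - (core A).card := by
  rw [mem_core nA] at hx
  push Not at hx
  obtain ⟨a, ha, hxa⟩ := hx
  have : (cov A).filter (fun K => x ∈ K) ⊆ (a \ core A).image (fun k => {x, k}) := by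
    intro K hK
    rw [mem_filter] at hK
    obtain ⟨v, hv, hva⟩ := cov_hit hK.1 ha
    rw [mem_image]
    refine ⟨v, mem_sdiff.2 ⟨hva, cov_not_core hK.1 hv⟩, ?_⟩
    exact (two_eq (mem_cov.1 hK.1).1.2 hK.2 hv (fun h => hxa (h ▸ hva))).symm
  refine (card_le_card this).trans (card_image_le.trans ?_)
  rw [card_sdiff_of_subset (core_sub ha), h3 a ha]

lemma cov_card (nA : A.Nonempty) (h3 : ∀ a ∈ A, a.card = 3) :
    (cov A).card ≤ (3 - (core A).card) * (3 - (core A).card) := by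
  obtain ⟨a, ha⟩ := nA
  have : cov A ⊆ (a \ core A).biUnion (fun x => (cov A).filter (fun K => x ∈ K)) := by
    intro K hK
    obtain ⟨v, hv, hva⟩ := cov_hit hK ha
    rw [mem_biUnion]
    exact ⟨v, mem_sdiff.2 ⟨hva, cov_not_core hK hv⟩, mem_filter.2 ⟨hK, hv⟩⟩
  refine (card_le_card this).trans ((card_biUnion_le_card_mul _ _ (3 - (core A).card) ?_).trans ?_)
  · intro x hx
    exact cov_deg ⟨a, ha⟩ h3 (mem_sdiff.1 hx).2
  · rw [card_sdiff_of_subset (core_sub ha), h3 a ha]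

/-- Intersecting families of 2-sets. -/
lemma graph_inter {T : Finset (Finset ℕ)} (h2 : ∀ K ∈ T, K.card = 2) (nT : T.Nonempty)
    (hI : ∀ K ∈ T, ∀ L ∈ T, ¬ Disjoint K L) :
    (∃ x, ∀ K ∈ T, x ∈ K) ∨ ∃ x y z, x ≠ y ∧ x ≠ z ∧ y ≠ z ∧ {x, y} ∈ T ∧ {y, z} ∈ T ∧ {x, z} ∈ T ∧
      T ⊆ {{x, y}, {y, z}, {x, z}} := by
  by_cases hs : ∃ x, ∀ K ∈ T, x ∈ K
  · exact Or.inl hs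
  right
  push Not at hs
  obtain ⟨K, hK⟩ := nT
  obtain ⟨x, y, hxy, rfl⟩ := card_eq_two.1 (h2 K hK)
  obtain ⟨L, hL, hxL⟩ := hs x
  obtain ⟨M, hM, hyM⟩ := hs y
  have hyL : y ∈ L := by
    obtain ⟨v, hv⟩ := not_disj (hI _ hK L hL)
    simp only [mem_inter, mem_insert, mem_singleton] at hv
    rcases hv with ⟨rfl | rfl, h⟩
    · exact absurd h hxL
    · exact h
  have hxM : x ∈ M := by
    obtain ⟨v, hv⟩ := not_disj (hI _ hK M hM)
    simp only [mem_inter, mem_insert, mem_singleton] at hv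
    rcases hv with ⟨rfl | rfl, h⟩
    · exact h
    · exact absurd h hyM
  obtain ⟨z, hz⟩ := not_disj (hI L hL M hM)
  rw [mem_inter] at hz
  have hzx : x ≠ z := by rintro rfl; exact hxL hz.1
  have hzy : y ≠ z := by rintro rfl; exact hyM hz.2
  have hLe := two_eq (h2 L hL) hyL hz.1 hzy
  have hMe := two_eq (h2 M hM) hxM hz.2 hzx
  subst hLe hMe
  refine ⟨x, y, z, hxy, hzx, hzy, hK, hL, hM, ?_⟩
  intro N hN
  have a1 := not_disj (hI N hN _ hK)
  have a2 := not_disj (hI N hN _ hL)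
  have a3 := not_disj (hI N hN _ hM)
  have hc := h2 N hN
  have b1 : x ∈ N ∨ y ∈ N := by
    obtain ⟨v, hv⟩ := a1
    simp only [mem_inter, mem_insert, mem_singleton] at hv
    rcases hv with ⟨h, rfl | rfl⟩ <;> simp [h]
  have b2 : y ∈ N ∨ z ∈ N := by
    obtain ⟨v, hv⟩ := a2
    simp only [mem_inter, mem_insert, mem_singleton] at hv
    rcases hv with ⟨h, rfl | rfl⟩ <;> simp [h]
  have b3 : x ∈ N ∨ z ∈ N := by
    obtain ⟨v, hv⟩ := a3
    simp only [mem_inter, mem_insert, mem_singleton] at hv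
    rcases hv with ⟨h, rfl | rfl⟩ <;> simp [h]
  simp only [mem_insert, mem_singleton]
  by_cases hx : x ∈ N
  · by_cases hy : y ∈ N
    · exact Or.inl (two_eq hc hx hy hxy)
    · exact Or.inr (Or.inr (two_eq hc hx (b2.resolve_left hy) hzx))
  · exact Or.inr (Or.inl (two_eq hc (b1.resolve_left hx) (b3.resolve_left hx) hzy))

/-- In a graph with small degrees and enough edges there are two disjoint edges. -/
lemma graph_disj {T : Finset (Finset ℕ)} (h2 : ∀ K ∈ T, K.card = 2)
    (hdeg : ∀ x, (T.filter (fun K => x ∈ K)).card ≤ 3) (hT : 4 ≤ T.card) :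
    ∃ K ∈ T, ∃ L ∈ T, Disjoint K L := by
  by_contra hcon
  push Not at hcon
  rcases graph_inter h2 (card_pos.1 (by omega)) hcon with ⟨x, hx⟩ | ⟨x, y, z, -, -, -, -, -, -, h⟩
  · have := hdeg x
    rw [filter_true_of_mem hx] at this
    omega
  · have := (card_le_card h).trans card_le_three
    omega

end Fam


/-- Edges meeting both cores. -/
def Rg (X Y : Finset ℕ) (H : Finset (Finset ℕ)) : Finset (Finset ℕ) :=
  H.filter (fun e => (e ∩ X).Nonempty ∧ (e ∩ Y).Nonempty)

section CfgS

variable {V : Finset ℕ} {H A B C : Finset (Finset ℕ)}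

lemma Cfg.A3 (h : Cfg V H A B C) : ∀ a ∈ A, a.card = 3 := fun a ha => (h.hV a (h.hA ha)).2

lemma Cfg.B3 (h : Cfg V H A B C) : ∀ a ∈ B, a.card = 3 := fun a ha => (h.hV a (h.hB ha)).2

lemma Cfg.USV (h : Cfg V H A B C) : US A ⊆ V := by
  intro x hx
  obtain ⟨a, ha, hxa⟩ := mem_biUnion.1 hx
  exact (h.hV a (h.hA ha)).1 hxa

lemma Cfg.disj (h : Cfg V H A B C) : Disjoint (US A) (US B) := by
  rw [disjoint_left]
  intro x hx hy
  obtain ⟨a, ha, hxa⟩ := mem_biUnion.1 hx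
  obtain ⟨b, hb, hxb⟩ := mem_biUnion.1 hy
  exact disjoint_left.1 (h.AB a ha b hb) hxa hxb

lemma Cfg.card_add (h : Cfg V H A B C) : (US A).card + (US B).card ≤ V.card := by
  rw [← card_union_of_disjoint h.disj]
  exact card_le_card (union_subset h.USV h.symm.USV)

lemma Cfg.classify1 (h : Cfg V H A B C) {c : Finset ℕ} (hc : c ∈ C)
    (hX : ¬ (c ∩ core A).Nonempty) : ∃ y ∈ core B, ∃ K ∈ cov A, c = insert y K := by
  have hn : ∀ v ∈ c, v ∉ core A := fun v hv hv' => hX ⟨v, mem_inter.2 ⟨hv, hv'⟩⟩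
  have c3 := (h.hV c (h.hC hc)).2
  obtain ⟨a, ha⟩ := h.nA
  obtain ⟨v, hv⟩ := h.CA c hc a ha
  rw [mem_inter] at hv
  have h1 := hn v hv.1
  rw [mem_core h.nA] at h1
  push Not at h1
  obtain ⟨a', ha', hva'⟩ := h1
  obtain ⟨u, hu⟩ := h.CA c hc a' ha'
  rw [mem_inter] at hu
  have huv : v ≠ u := by rintro rfl; exact hva' hu.2
  obtain ⟨b, hb⟩ := h.nB
  obtain ⟨y, hy⟩ := h.CB c hc b hb
  rw [mem_inter] at hy
  have hvA := sub_US ha hv.2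
  have huA := sub_US ha' hu.2
  have hyB := sub_US hb hy.2
  have dj := disjoint_left.1 h.disj
  have hvy : y ≠ v := by rintro rfl; exact dj hvA hyB
  have huy : y ≠ u := by rintro rfl; exact dj huA hyB
  have hce : c = {y, v, u} := three_eq c3 hy.1 hv.1 hu.1 hvy huy huv
  refine ⟨y, ?_, {v, u}, ?_, hce⟩
  · rw [mem_core h.nB]
    intro b' hb'
    obtain ⟨z, hz⟩ := h.CB c hc b' hb'
    rw [mem_inter] at hz
    have hz1 := hz.1
    rw [hce] at hz1
    simp only [mem_insert, mem_singleton] at hz1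
    rcases hz1 with rfl | rfl | rfl
    · exact hz.2
    · exact absurd (sub_US hb' hz.2) (dj hvA)
    · exact absurd (sub_US hb' hz.2) (dj huA)
  · rw [mem_cov]
    refine ⟨⟨?_, card_pair huv⟩, ?_⟩
    · intro z hz
      simp only [mem_insert, mem_singleton] at hz
      rcases hz with rfl | rfl
      · exact mem_sdiff.2 ⟨hvA, hn _ hv.1⟩
      · exact mem_sdiff.2 ⟨huA, hn _ hu.1⟩
    · intro a'' ha''
      obtain ⟨z, hz⟩ := h.CA c hc a'' ha''
      rw [mem_inter] at hz
      have hz1 := hz.1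
      rw [hce] at hz1
      refine ⟨z, mem_inter.2 ⟨?_, hz.2⟩⟩
      simp only [mem_insert, mem_singleton] at hz1 ⊢
      rcases hz1 with rfl | h | h
      · exact absurd hyB (dj (sub_US ha'' hz.2))
      · exact Or.inl h
      · exact Or.inr h

/-- Exceptional edges -/
def Ex (Y : Finset ℕ) (T : Finset (Finset ℕ)) : Finset (Finset ℕ) :=
  T.biUnion (fun K => Y.image (fun y => insert y K))

lemma mem_Ex {Y : Finset ℕ} {T : Finset (Finset ℕ)} {c : Finset ℕ} :
    c ∈ Ex Y T ↔ ∃ K ∈ T, ∃ y ∈ Y, insert y K = c := by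
  simp [Ex]

lemma Ex_card (Y : Finset ℕ) (T : Finset (Finset ℕ)) : (Ex Y T).card ≤ Y.card * T.card := by
  rw [mul_comm]
  exact card_biUnion_le_card_mul _ _ _ (fun K _ => card_image_le)

lemma Cfg.classify (h : Cfg V H A B C) {c : Finset ℕ} (hc : c ∈ C) :
    c ∈ Rg (core A) (core B) H ∨ c ∈ Ex (core A) (cov B) ∨ c ∈ Ex (core B) (cov A) := by
  by_cases h1 : (c ∩ core A).Nonempty
  · by_cases h2 : (c ∩ core B).Nonempty
    · exact Or.inl (mem_filter.2 ⟨h.hC hc, h1, h2⟩)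
    · obtain ⟨y, hy, K, hK, he⟩ := h.symm.classify1 hc h2
      exact Or.inr (Or.inl (mem_Ex.2 ⟨K, hK, y, hy, he.symm⟩))
  · obtain ⟨y, hy, K, hK, he⟩ := h.classify1 hc h1
    exact Or.inr (Or.inr (mem_Ex.2 ⟨K, hK, y, hy, he.symm⟩))

lemma Cfg.card_le (h : Cfg V H A B C) :
    H.card ≤ A.card + B.card + (Rg (core A) (core B) H).card + (core A).card * (cov B).card
      + (core B).card * (cov A).card := by
  have : H ⊆ A ∪ B ∪ Rg (core A) (core B) H ∪ Ex (core A) (cov B) ∪ Ex (core B) (cov A) := by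
    intro e he
    simp only [mem_union]
    rcases h.cover e he with h1 | h1 | h1
    · tauto
    · tauto
    · have := h.classify h1
      tauto
  have h1 := card_le_card this
  have h2 := card_union_le (A ∪ B ∪ Rg (core A) (core B) H ∪ Ex (core A) (cov B))
    (Ex (core B) (cov A))
  have h3 := card_union_le (A ∪ B ∪ Rg (core A) (core B) H) (Ex (core A) (cov B))
  have h4 := card_union_le (A ∪ B) (Rg (core A) (core B) H)
  have h5 := card_union_le A B
  have h6 := Ex_card (core A) (cov B)
  have h7 := Ex_card (core B) (cov A)
  omega

end CfgS

section Core1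

variable {A : Finset (Finset ℕ)} {w : ℕ}

/-- The link of the centre. -/
lemma core1_card (h3 : ∀ a ∈ A, a.card = 3) (hc : core A = {w}) :
    A.card ≤ ((US A).card - 1).choose 2 := by
  have hw : ∀ a ∈ A, w ∈ a := fun a ha => core_sub ha (by rw [hc]; simp)
  have hwU : w ∈ US A := core_sub_US (by rw [hc]; simp)
  have : A ⊆ (((US A).erase w).powersetCard 2).image (fun s => insert w s) := by
    intro a ha
    rw [mem_image]
    refine ⟨a.erase w, ?_, insert_erase (hw a ha)⟩
    rw [mem_powersetCard]
    exact ⟨erase_subset_erase _ (sub_US ha), by rw [card_erase_of_mem (hw a ha), h3 a ha]⟩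
  refine (card_le_card this).trans (card_image_le.trans ?_)
  rw [card_powersetCard, card_erase_of_mem hwU]

lemma core1_cov1 (h3 : ∀ a ∈ A, a.card = 3) (hc : core A = {w})
    (hT : (cov A).Nonempty) : A.card ≤ 2 * (US A).card - 5 := by
  have hw : ∀ a ∈ A, w ∈ a := fun a ha => core_sub ha (by rw [hc]; simp)
  have hwU : w ∈ US A := core_sub_US (by rw [hc]; simp)
  obtain ⟨K, hK⟩ := hT
  obtain ⟨⟨hKU, hK2⟩, _⟩ := mem_cov.1 hK
  obtain ⟨x, y, hxy, rfl⟩ := card_eq_two.1 hK2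
  rw [hc] at hKU
  have hx := hKU (show x ∈ ({x, y} : Finset ℕ) by simp)
  have hy := hKU (show y ∈ ({x, y} : Finset ℕ) by simp)
  simp only [mem_sdiff, mem_singleton] at hx hy
  have : A ⊆ (((US A).erase w).erase x).image (fun s => {w, x, s}) ∪
      ((((US A).erase w).erase x).erase y).image (fun s => {w, y, s}) := by
    intro a ha
    rw [mem_union, mem_image, mem_image]
    by_cases hxa : x ∈ a
    · left
      obtain ⟨s, hs, hsa, he⟩ := three_insert (P := {w, x}) (h3 a ha)
        (card_pair (Ne.symm hx.2)) (by
          intro z hz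
          simp only [mem_insert, mem_singleton] at hz
          rcases hz with rfl | rfl
          · exact hw a ha
          · exact hxa)
      simp only [mem_insert, mem_singleton, not_or] at hs
      refine ⟨s, by simp [hs, sub_US ha hsa], ?_⟩
      rw [he]; ext z; simp only [mem_insert, mem_singleton]; tauto
    · right
      obtain ⟨v, hv, hva⟩ := cov_hit hK ha
      simp only [mem_insert, mem_singleton] at hv
      have hya : y ∈ a := by
        rcases hv with rfl | rfl
        · exact absurd hva hxa
        · exact hva
      obtain ⟨s, hs, hsa, he⟩ := three_insert (P := {w, y}) (h3 a ha)
        (card_pair (Ne.symm hy.2)) (by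
          intro z hz
          simp only [mem_insert, mem_singleton] at hz
          rcases hz with rfl | rfl
          · exact hw a ha
          · exact hya)
      simp only [mem_insert, mem_singleton, not_or] at hs
      have hsx : s ≠ x := by rintro rfl; exact hxa hsa
      refine ⟨s, by simp [hs, hsx, sub_US ha hsa], ?_⟩
      rw [he]; ext z; simp only [mem_insert, mem_singleton]; tauto
  have h1 := card_le_card this
  have h2 := card_union_le ((((US A).erase w).erase x).image (fun s => ({w, x, s} : Finset ℕ)))
    (((((US A).erase w).erase x).erase y).image (fun s => {w, y, s}))
  have h4 := card_image_le (s := ((US A).erase w).erase x) (f := fun s => ({w, x, s} : Finset ℕ))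
  have h5 := card_image_le (s := (((US A).erase w).erase x).erase y)
    (f := fun s => ({w, y, s} : Finset ℕ))
  have e1 : ((US A).erase w).card = (US A).card - 1 := card_erase_of_mem hwU
  have e2 : (((US A).erase w).erase x).card = (US A).card - 1 - 1 := by
    rw [card_erase_of_mem (by simp [hx]), e1]
  have e3 : ((((US A).erase w).erase x).erase y).card = (US A).card - 1 - 1 - 1 := by
    rw [card_erase_of_mem (by simp [hy, Ne.symm hxy]), e2]
  have e4 : 0 < ((((US A).erase w).erase x)).card := card_pos.2 ⟨y, by simp [hy, Ne.symm hxy]⟩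
  omega

lemma core1_cov3 (nA : A.Nonempty) (h3 : ∀ a ∈ A, a.card = 3) (hc : core A = {w})
    (hT : 3 ≤ (cov A).card) : A.card ≤ 3 := by
  have hw : ∀ a ∈ A, w ∈ a := fun a ha => core_sub ha (by rw [hc]; simp)
  have hwK : ∀ K ∈ cov A, w ∉ K := fun K hK hwK => cov_not_core hK hwK (by rw [hc]; simp)
  have h2 : ∀ K ∈ cov A, K.card = 2 := fun K hK => (mem_cov.1 hK).1.2
  by_cases hI : ∀ K ∈ cov A, ∀ L ∈ cov A, ¬ Disjoint K L
  · rcases graph_inter h2 (card_pos.1 (by omega)) hI with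
      ⟨x, hx⟩ | ⟨x, y, z, hxy, hxz, hyz, h1, h4, h5, -⟩
    · exfalso
      obtain ⟨K, hK⟩ := card_pos.1 (show 0 < (cov A).card by omega)
      have := cov_deg nA h3 (cov_not_core hK (hx K hK))
      rw [filter_true_of_mem hx, hc, card_singleton] at this
      omega
    · have : A ⊆ {{w, x, y}, {w, y, z}, {w, x, z}} := by
        intro a ha
        obtain ⟨u1, hu1, ha1⟩ := cov_hit h1 ha
        obtain ⟨u2, hu2, ha2⟩ := cov_hit h4 ha
        obtain ⟨u3, hu3, ha3⟩ := cov_hit h5 ha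
        have n1 := hwK _ h1
        have n2 := hwK _ h4
        simp only [mem_insert, mem_singleton, not_or] at hu1 hu2 hu3 n1 n2 ⊢
        have H1 := fun hx hy => three_eq (h3 a ha) (hw a ha) hx hy n1.1 n1.2 hxy
        have H2 := fun hx hy => three_eq (h3 a ha) (hw a ha) hx hy n2.1 n2.2 hyz
        have H3 := fun hx hy => three_eq (h3 a ha) (hw a ha) hx hy n1.1 n2.2 hxz
        have b1 : x ∈ a ∨ y ∈ a := by rcases hu1 with rfl | rfl <;> simp [ha1]
        have b2 : y ∈ a ∨ z ∈ a := by rcases hu2 with rfl | rfl <;> simp [ha2]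
        have b3 : x ∈ a ∨ z ∈ a := by rcases hu3 with rfl | rfl <;> simp [ha3]
        by_cases hxa : x ∈ a
        · by_cases hya : y ∈ a
          · exact Or.inl (H1 hxa hya)
          · exact Or.inr (Or.inr (H3 hxa (b2.resolve_left hya)))
        · exact Or.inr (Or.inl (H2 (b1.resolve_left hxa) (b3.resolve_left hxa)))
      exact (card_le_card this).trans card_le_three
  · push Not at hI
    obtain ⟨K, hK, L, hL, hd⟩ := hI
    obtain ⟨M, hM⟩ : ((cov A) \ {K, L}).Nonempty := by
      rw [← card_pos]
      have := le_card_sdiff {K, L} (cov A)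
      have := card_le_two (a := K) (b := L)
      omega
    simp only [mem_sdiff, mem_insert, mem_singleton, not_or] at hM
    obtain ⟨hM, hMK, hML⟩ := hM
    have hsub : A ⊆ (K ×ˢ L).image (fun p => {w, p.1, p.2}) := by
      intro a ha
      obtain ⟨i, hi, hia⟩ := cov_hit hK ha
      obtain ⟨j, hj, hja⟩ := cov_hit hL ha
      rw [mem_image]
      refine ⟨(i, j), mem_product.2 ⟨hi, hj⟩, (three_eq (h3 a ha) (hw a ha) hia hja ?_ ?_ ?_).symm⟩
      · rintro rfl; exact hwK _ hK hi
      · rintro rfl; exact hwK _ hL hj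
      · rintro rfl; exact disjoint_left.1 hd hi hj
    have hKM : ∃ i ∈ K, i ∉ M := by
      by_contra hcon
      push Not at hcon
      exact hMK (eq_of_subset_of_card_le hcon (by rw [h2 K hK, h2 M hM])).symm
    have hLM : ∃ i ∈ L, i ∉ M := by
      by_contra hcon
      push Not at hcon
      exact hML (eq_of_subset_of_card_le hcon (by rw [h2 L hL, h2 M hM])).symm
    obtain ⟨i, hi, hiM⟩ := hKM
    obtain ⟨j, hj, hjM⟩ := hLM
    have hsub' : A ⊆ ((K ×ˢ L).erase (i, j)).image (fun p => {w, p.1, p.2}) := by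
      intro a ha
      obtain ⟨p, hp, rfl⟩ := mem_image.1 (hsub ha)
      refine mem_image.2 ⟨p, mem_erase.2 ⟨?_, hp⟩, rfl⟩
      rintro rfl
      obtain ⟨v, hv, hva⟩ := cov_hit hM ha
      simp only [mem_insert, mem_singleton] at hva
      rcases hva with rfl | rfl | rfl
      · exact hwK _ hM hv
      · exact hiM hv
      · exact hjM hv
    refine (card_le_card hsub').trans (card_image_le.trans ?_)
    rw [card_erase_of_mem (mem_product.2 ⟨hi, hj⟩), card_product, h2 K hK, h2 L hL]

end Core1


lemma two_choose (k : ℕ) : 2 * (k + 1).choose 2 = (k + 1) * k := by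
  induction k with
  | zero => rfl
  | succ k ih =>
    rw [Nat.choose_succ_succ' (k + 1) 1, mul_add, ih, Nat.choose_one_right]
    ring

/-- Edges `P ∪ {s}`, `s ∈ M`. -/
def Im (H : Finset (Finset ℕ)) (P M : Finset ℕ) : Finset (Finset ℕ) :=
  (M.filter (fun s => insert s P ∈ H)).image (fun s => insert s P)

/-- Number of edges `P ∪ {s}`, `s ∈ M`. -/
def dg (H : Finset (Finset ℕ)) (P M : Finset ℕ) : ℕ :=
  (M.filter (fun s => insert s P ∈ H)).card

/-- Indicator. -/
def ind (H : Finset (Finset ℕ)) (e : Finset ℕ) : ℕ := if e ∈ H then 1 else 0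

lemma Im_card (H : Finset (Finset ℕ)) (P M : Finset ℕ) : (Im H P M).card ≤ dg H P M :=
  card_image_le

lemma dg_le (H : Finset (Finset ℕ)) (P M : Finset ℕ) : dg H P M ≤ M.card := card_filter_le _ _

lemma mem_Im {H : Finset (Finset ℕ)} {P M : Finset ℕ} {s : ℕ} (hs : s ∈ M)
    (h : insert s P ∈ H) : insert s P ∈ Im H P M :=
  mem_image.2 ⟨s, mem_filter.2 ⟨hs, h⟩, rfl⟩

lemma ind_le (H : Finset (Finset ℕ)) (e : Finset ℕ) : ind H e ≤ 1 := by
  unfold ind; split_ifs <;> omega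

lemma dg_insert (H : Finset (Finset ℕ)) (P M : Finset ℕ) {s : ℕ} (hs : s ∉ M) :
    dg H P (insert s M) = ind H (insert s P) + dg H P M := by
  unfold dg ind
  rw [filter_insert]
  split_ifs with h
  · rw [card_insert_of_notMem (by simp [hs])]; omega
  · omega

/-- Shape of regular edges -/
lemma Rg_shape {V X Y : Finset ℕ} {H : Finset (Finset ℕ)} (hV : ThreeGraphOn V H)
    (hXY : Disjoint X Y) {c : Finset ℕ} (hc : c ∈ Rg X Y H) :
    ∃ i ∈ X, ∃ j ∈ Y, ∃ s ∈ V, s ≠ i ∧ s ≠ j ∧ i ≠ j ∧ c = insert s {i, j} ∧ insert s {i, j} ∈ H := by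
  obtain ⟨hcH, ⟨i, hi⟩, ⟨j, hj⟩⟩ := mem_filter.1 hc
  rw [mem_inter] at hi hj
  have hij : i ≠ j := by rintro rfl; exact disjoint_left.1 hXY hi.2 hj.2
  obtain ⟨s, hs, hsc, he⟩ := three_insert (P := {i, j}) (hV c hcH).2 (card_pair hij) (by
    intro z hz
    simp only [mem_insert, mem_singleton] at hz
    rcases hz with rfl | rfl
    · exact hi.1
    · exact hj.1)
  simp only [mem_insert, mem_singleton, not_or] at hs
  exact ⟨i, hi.2, j, hj.2, s, (hV c hcH).1 hsc, hs.1, hs.2, hij, he, he ▸ hcH⟩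

section CaseII

variable {V : Finset ℕ} {H A B C : Finset (Finset ℕ)}

lemma Cfg.coreV (h : Cfg V H A B C) : core A ⊆ V := core_sub_US.trans h.USV

lemma Cfg.coreD (h : Cfg V H A B C) : Disjoint (core A) (core B) :=
  disjoint_of_subset_left core_sub_US (disjoint_of_subset_right core_sub_US h.disj)

lemma case11 (h : Cfg V H A B C) (hn : 9 ≤ V.card) (hA : (core A).card = 1)
    (hB : (core B).card = 1) : H.card ≤ (V.card - 1).choose 2 := by
  obtain ⟨x, hx⟩ := card_eq_one.1 hA
  obtain ⟨y, hy⟩ := card_eq_one.1 hB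
  have h1 := core1_card h.A3 hx
  have h2 := core1_card h.B3 hy
  have h3 := cov_card h.nA h.A3
  have h4 := cov_card h.nB h.B3
  have h5 := US_card_ge4 h.nA h.A3 (by omega)
  have h6 := US_card_ge4 h.nB h.B3 (by omega)
  have h7 := h.card_add
  have h8 := h.card_le
  rw [hA, hB] at h8
  rw [hA] at h3
  rw [hB] at h4
  have hxV : x ∈ V := h.coreV (by rw [hx]; simp)
  have hyV : y ∈ V := h.symm.coreV (by rw [hy]; simp)
  have hR : (Rg (core A) (core B) H).card ≤ V.card - 2 := by
    have : Rg (core A) (core B) H ⊆ Im H {x, y} ((V.erase x).erase y) := by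
      intro c hc
      obtain ⟨i, hi, j, hj, s, hs, hsi, hsj, hij, rfl, hH⟩ := Rg_shape h.hV h.coreD hc
      rw [hx, mem_singleton] at hi
      rw [hy, mem_singleton] at hj
      subst hi hj
      exact mem_Im (by simp [hs, hsi, hsj]) hH
    have hxy : x ≠ y := by
      have := h.coreD
      rw [hx, hy] at this
      simpa using this
    refine (card_le_card this).trans ((Im_card _ _ _).trans ((dg_le _ _ _).trans ?_))
    rw [card_erase_of_mem (by simp [hyV, Ne.symm hxy]), card_erase_of_mem hxV]; omega
  obtain ⟨P, hP⟩ := Nat.exists_eq_add_of_le h5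
  obtain ⟨Q, hQ⟩ := Nat.exists_eq_add_of_le h6
  obtain ⟨r, hr⟩ := Nat.exists_eq_add_of_le h7
  have e1 : (US A).card - 1 = P + 2 + 1 := by omega
  have e2 : (US B).card - 1 = Q + 2 + 1 := by omega
  have e3 : V.card - 1 = P + Q + r + 6 + 1 := by omega
  rw [e1] at h1
  rw [e2] at h2
  rw [e3]
  have c1 := two_choose (P + 2)
  have c2 := two_choose (Q + 2)
  have c3 := two_choose (P + Q + r + 6)
  have : V.card - 2 = P + Q + r + 6 := by omega
  rw [this] at hR
  nlinarith [Nat.zero_le (P * Q), Nat.zero_le (P * r), Nat.zero_le (Q * r), Nat.zero_le (r * r)]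

lemma case21 (h : Cfg V H A B C) (hn : 9 ≤ V.card) (hA : (core A).card = 2)
    (hB : (core B).card = 1) : H.card ≤ (V.card - 1).choose 2 := by
  obtain ⟨x, x', hxx, hx⟩ := card_eq_two.1 hA
  obtain ⟨y, hy⟩ := card_eq_one.1 hB
  have h1 := core2_card h.A3 hA
  have h2 := core1_card h.B3 hy
  have h2' := core1_cov3 h.nB h.B3 hy
  have h3 := (core2_cov h.nA h.A3 hA).1
  have h4 := cov_card h.nB h.B3
  have h5 := US_card_ge4 h.nA h.A3 (by omega)
  have h6 := US_card_ge4 h.nB h.B3 (by omega)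
  have h7 := h.card_add
  have h8 := h.card_le
  rw [hA, hB] at h8
  rw [hB] at h4
  have hxV : x ∈ V := h.coreV (by rw [hx]; simp)
  have hxV' : x' ∈ V := h.coreV (by rw [hx]; simp)
  have hyV : y ∈ V := h.symm.coreV (by rw [hy]; simp)
  have hR : (Rg (core A) (core B) H).card ≤ 2 * V.card - 5 := by
    have : Rg (core A) (core B) H ⊆ Im H {x, y} ((V.erase x).erase y) ∪
        Im H {x', y} (((V.erase x).erase y).erase x') := by
      intro c hc
      obtain ⟨i, hi, j, hj, s, hs, hsi, hsj, hij, rfl, hH⟩ := Rg_shape h.hV h.coreD hc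
      rw [hx, mem_insert, mem_singleton] at hi
      rw [hy, mem_singleton] at hj
      subst hj
      rw [mem_union]
      rcases hi with rfl | rfl
      · exact Or.inl (mem_Im (by simp [hs, hsi, hsj]) hH)
      · by_cases hsx : s = x
        · subst hsx
          have e : insert s {i, j} = insert i ({s, j} : Finset ℕ) := insert_comm _ _ _
          rw [e] at hH ⊢
          exact Or.inl (mem_Im (by simp [hxV', hxx.symm, hij]) hH)
        · exact Or.inr (mem_Im (by simp [hs, hsi, hsj, hsx]) hH)
    have hd := h.coreD
    rw [hx, hy] at hd
    simp only [disjoint_singleton_right, mem_insert, mem_singleton, not_or] at hd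
    have d1 := card_le_card this
    have d2 := card_union_le (Im H {x, y} ((V.erase x).erase y))
      (Im H {x', y} (((V.erase x).erase y).erase x'))
    have d3 := (Im_card H {x, y} ((V.erase x).erase y)).trans (dg_le _ _ _)
    have d4 := (Im_card H {x', y} (((V.erase x).erase y).erase x')).trans (dg_le _ _ _)
    rw [card_erase_of_mem (by simp [hxV', hxx.symm, Ne.symm hd.2])] at d4
    rw [card_erase_of_mem (by simp [hyV, hd.1]), card_erase_of_mem hxV] at d3 d4
    omega
  obtain ⟨P, hP⟩ := Nat.exists_eq_add_of_le h5
  obtain ⟨Q, hQ⟩ := Nat.exists_eq_add_of_le h6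
  obtain ⟨r, hr⟩ := Nat.exists_eq_add_of_le h7
  have e2 : (US B).card - 1 = Q + 2 + 1 := by omega
  have e3 : V.card - 1 = P + Q + r + 6 + 1 := by omega
  rw [e2] at h2
  rw [e3]
  have c2 := two_choose (Q + 2)
  have c3 := two_choose (P + Q + r + 6)
  have e4 : 2 * V.card - 5 = 2 * (P + Q + r) + 11 := by omega
  have e5 : (US A).card - 2 = P + 2 := by omega
  rw [e4] at hR
  rw [e5] at h1
  have e6 : 1 ≤ P + Q + r := by omega
  by_cases hc : 3 ≤ (cov B).card
  · have := h2' hc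
    nlinarith [Nat.zero_le (P * Q), Nat.zero_le (P * r), Nat.zero_le (Q * r), Nat.zero_le (r * r),
      Nat.zero_le (P * P), Nat.zero_le (Q * Q)]
  · nlinarith [Nat.zero_le (P * Q), Nat.zero_le (P * r), Nat.zero_le (Q * r), Nat.zero_le (r * r),
      Nat.zero_le (P * P), Nat.zero_le (Q * Q)]

/-- couple lemma -/
lemma couple {V : Finset ℕ} {H : Finset (Finset ℕ)} (free : P4Free H) (hn : 9 ≤ V.card)
    {x x' y y' : ℕ} (hx : x ∈ V) (hx' : x' ∈ V) (hy : y ∈ V) (hy' : y' ∈ V)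
    (hxx : x ≠ x') (hyy : y ≠ y') (h1 : x ≠ y) (h2 : x ≠ y') (h3 : x' ≠ y) (h4 : x' ≠ y') :
    dg H {x, y} (V \ {x, x', y, y'}) + dg H {x', y'} (V \ {x, x', y, y'}) ≤ V.card - 3 := by
  have hc4 : ({x, x', y, y'} : Finset ℕ).card = 4 := by
    rw [card_insert_of_notMem (by simp [*]), card_insert_of_notMem (by simp [*]), card_pair hyy]
  have hc : (V \ {x, x', y, y'}).card = V.card - 4 := by
    rw [card_sdiff_of_subset, hc4]
    intro z hz
    simp only [mem_insert, mem_singleton] at hz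
    rcases hz with rfl | rfl | rfl | rfl <;> assumption
  have := pair_lemma free (P := {x, y}) (Q := {x', y'}) (M := V \ {x, x', y, y'}) (by simp)
    (by simp) (by simp [h3, Ne.symm hxx, Ne.symm h2, Ne.symm hyy])
    (by rw [disjoint_left]; intro z hz; simp only [mem_insert, mem_singleton] at hz; simp; tauto)
    (by rw [disjoint_left]; intro z hz; simp only [mem_insert, mem_singleton] at hz; simp; tauto)
    (by omega)
  unfold dg
  omega

lemma case22 (h : Cfg V H A B C) (hn : 9 ≤ V.card) (hA : (core A).card = 2)
    (hB : (core B).card = 2) : H.card ≤ (V.card - 1).choose 2 := by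
  obtain ⟨x, x', hxx, hx⟩ := card_eq_two.1 hA
  obtain ⟨y, y', hyy, hy⟩ := card_eq_two.1 hB
  have h1 := core2_card h.A3 hA
  have h2 := core2_card h.B3 hB
  have h3 := (core2_cov h.nA h.A3 hA).1
  have h4 := (core2_cov h.nB h.B3 hB).1
  have h5 := US_card_ge4 h.nA h.A3 (by omega)
  have h6 := US_card_ge4 h.nB h.B3 (by omega)
  have h7 := h.card_add
  have h8 := h.card_le
  rw [hA, hB] at h8
  have hxV : x ∈ V := h.coreV (by rw [hx]; simp)
  have hxV' : x' ∈ V := h.coreV (by rw [hx]; simp)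
  have hyV : y ∈ V := h.symm.coreV (by rw [hy]; simp)
  have hyV' : y' ∈ V := h.symm.coreV (by rw [hy]; simp)
  have hd := h.coreD
  rw [hx, hy] at hd
  simp only [disjoint_insert_left, disjoint_singleton_left, mem_insert, mem_singleton,
    not_or] at hd
  obtain ⟨⟨d1, d2⟩, d3, d4⟩ := hd
  have c1 := couple h.free hn hxV hxV' hyV hyV' hxx hyy d1 d2 d3 d4
  have c2 := couple h.free hn hxV hxV' hyV' hyV hxx hyy.symm d2 d1 d4 d3
  rw [pair_comm y' y] at c2
  set M := V \ {x, x', y, y'} with hM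
  have hR : Rg (core A) (core B) H ⊆ Im H {x, y} M ∪ Im H {x', y'} M ∪ (Im H {x, y'} M ∪
      Im H {x', y} M) ∪ ({x, x', y, y'} : Finset ℕ).powersetCard 3 := by
    intro c hc
    obtain ⟨i, hi, j, hj, s, hs, hsi, hsj, hij, rfl, hH⟩ := Rg_shape h.hV h.coreD hc
    rw [hx, mem_insert, mem_singleton] at hi
    rw [hy, mem_insert, mem_singleton] at hj
    by_cases hsM : s ∈ M
    · have := mem_Im hsM hH
      simp only [mem_union]
      rcases hi with rfl | rfl <;> rcases hj with rfl | rfl <;> tauto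
    · refine mem_union_right _ (mem_powersetCard.2 ⟨?_, (h.hV _ hH).2⟩)
      simp only [hM, mem_sdiff, hs, true_and, not_not] at hsM
      intro z hz
      simp only [mem_insert, mem_singleton] at hz
      rcases hz with rfl | rfl | rfl
      · exact hsM
      · rcases hi with rfl | rfl <;> simp
      · rcases hj with rfl | rfl <;> simp
  have hR1 := card_le_card hR
  have u1 := card_union_le (Im H {x, y} M ∪ Im H {x', y'} M ∪ (Im H {x, y'} M ∪
      Im H {x', y} M)) (({x, x', y, y'} : Finset ℕ).powersetCard 3)
  have u2 := card_union_le (Im H {x, y} M ∪ Im H {x', y'} M) (Im H {x, y'} M ∪ Im H {x', y} M)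
  have u3 := card_union_le (Im H {x, y} M) (Im H {x', y'} M)
  have u4 := card_union_le (Im H {x, y'} M) (Im H {x', y} M)
  have u5 : (({x, x', y, y'} : Finset ℕ).powersetCard 3).card = 4 := by
    rw [card_powersetCard, card_insert_of_notMem (by simp [*]),
      card_insert_of_notMem (by simp [*]), card_pair hyy]; rfl
  have i1 := Im_card H {x, y} M
  have i2 := Im_card H {x', y'} M
  have i3 := Im_card H {x, y'} M
  have i4 := Im_card H {x', y} M
  obtain ⟨m, hm⟩ := Nat.exists_eq_add_of_le hn
  have e : V.card - 1 = m + 7 + 1 := by omega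
  have c3 := two_choose (m + 7)
  rw [e]
  have : H.card ≤ 3 * m + 25 := by omega
  nlinarith

set_option maxHeartbeats 1000000 in
lemma case32 (h : Cfg V H A B C) (hn : 9 ≤ V.card) (hA : (core A).card = 3)
    (hB : (core B).card = 2) : H.card ≤ (V.card - 1).choose 2 := by
  obtain ⟨x, y, z, hxy, hxz, hyz, hx⟩ := card_eq_three.1 hA
  obtain ⟨w, w', hww, hw⟩ := card_eq_two.1 hB
  obtain ⟨hA1, hUS, hcov⟩ := core3 h.nA h.A3 hA
  have h1 : A.card = 1 := by rw [hA1]; simp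
  have h2 := core2_card h.B3 hB
  obtain ⟨h3, h4⟩ := core2_cov h.nB h.B3 hB
  have h7 := h.card_add
  rw [hUS, hA] at h7
  have h8 := h.card_le
  rw [hA, hB, hcov, card_empty] at h8
  have hxV : x ∈ V := h.coreV (by rw [hx]; simp)
  have hyV : y ∈ V := h.coreV (by rw [hx]; simp)
  have hzV : z ∈ V := h.coreV (by rw [hx]; simp)
  have hwV : w ∈ V := h.symm.coreV (by rw [hw]; simp)
  have hwV' : w' ∈ V := h.symm.coreV (by rw [hw]; simp)
  have hd := h.coreD
  rw [hx, hw] at hd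
  simp only [disjoint_insert_left, disjoint_singleton_left, mem_insert, mem_singleton,
    not_or] at hd
  obtain ⟨⟨d1, d2⟩, ⟨d3, d4⟩, d5, d6⟩ := hd
  have c1 := couple h.free hn hxV hyV hwV hwV' hxy hww d1 d2 d3 d4
  have c2 := couple h.free hn hyV hzV hwV hwV' hyz hww d3 d4 d5 d6
  have c3 := couple h.free hn hzV hxV hwV hwV' hxz.symm hww d5 d6 d1 d2
  set M1 := V \ {x, y, w, w'} with hM1
  set M2 := V \ {y, z, w, w'} with hM2
  set M3 := V \ {z, x, w, w'} with hM3
  have hR : Rg (core A) (core B) H ⊆ Im H {x, w} M1 ∪ Im H {y, w'} M1 ∪ (Im H {y, w} M2 ∪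
      Im H {z, w'} M2) ∪ (Im H {z, w} M3 ∪ Im H {x, w'} M3) ∪
      {{x, w, w'}, {y, w, w'}, {z, w, w'}} := by
    intro c hc
    obtain ⟨i, hi, j, hj, s, hs, hsi, hsj, hij, rfl, hH⟩ := Rg_shape h.hV h.coreD hc
    rw [hx, mem_insert, mem_insert, mem_singleton] at hi
    rw [hw, mem_insert, mem_singleton] at hj
    by_cases hsw : s = w ∨ s = w'
    · have : insert s ({i, j} : Finset ℕ) = {i, w, w'} := by
        rcases hsw with rfl | rfl <;> rcases hj with rfl | rfl
        · exact absurd rfl hsj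
        · exact insert_comm _ _ _
        · rw [insert_comm, pair_comm]
        · exact absurd rfl hsj
      rw [this]
      simp only [mem_union, mem_insert, mem_singleton]
      right
      rcases hi with rfl | rfl | rfl <;> simp
    · push Not at hsw
      have key : ∀ (a b : ℕ) (M : Finset ℕ), a ∈ M → insert s ({i, j} : Finset ℕ) = insert a {b, j} →
          insert s ({i, j} : Finset ℕ) ∈ Im H {b, j} M := by
        intro a b M ha he
        rw [he] at hH ⊢
        exact mem_Im ha hH
      have sw : insert s ({i, j} : Finset ℕ) = insert i {s, j} := insert_comm _ _ _
      simp only [mem_union]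
      rcases hj with rfl | rfl
      · rcases hi with rfl | rfl | rfl
        · by_cases hsy : s = y
          · subst hsy
            have := key _ _ M2 (by simp [*]) sw
            simp only [this, true_or, or_true]
          · have := key _ _ M1 (by simp [*]) rfl
            simp only [this, true_or, or_true]
        · by_cases hsy : s = z
          · subst hsy
            have := key _ _ M3 (by simp [*, Ne.symm hxy]) sw
            simp only [this, true_or, or_true]
          · have := key _ _ M2 (by simp [*]) rfl
            simp only [this, true_or, or_true]
        · by_cases hsy : s = x
          · subst hsy
            have := key _ _ M1 (by simp [*, Ne.symm hxz, Ne.symm hyz]) sw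
            simp only [this, true_or, or_true]
          · have := key _ _ M3 (by simp [*]) rfl
            simp only [this, true_or, or_true]
      · rcases hi with rfl | rfl | rfl
        · by_cases hsy : s = z
          · subst hsy
            have := key _ _ M2 (by simp [*]) sw
            simp only [this, true_or, or_true]
          · have := key _ _ M3 (by simp [*]) rfl
            simp only [this, true_or, or_true]
        · by_cases hsy : s = x
          · subst hsy
            have := key _ _ M3 (by simp [*, Ne.symm hxy]) sw
            simp only [this, true_or, or_true]
          · have := key _ _ M1 (by simp [*]) rfl
            simp only [this, true_or, or_true]
        · by_cases hsy : s = y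
          · subst hsy
            have := key _ _ M1 (by simp [*, Ne.symm hxz, Ne.symm hyz]) sw
            simp only [this, true_or, or_true]
          · have := key _ _ M2 (by simp [*]) rfl
            simp only [this, true_or, or_true]
  have hR1 := card_le_card hR
  have u1 := card_union_le (Im H {x, w} M1 ∪ Im H {y, w'} M1 ∪ (Im H {y, w} M2 ∪
      Im H {z, w'} M2) ∪ (Im H {z, w} M3 ∪ Im H {x, w'} M3))
      {{x, w, w'}, {y, w, w'}, {z, w, w'}}
  have u2 := card_union_le (Im H {x, w} M1 ∪ Im H {y, w'} M1 ∪ (Im H {y, w} M2 ∪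
      Im H {z, w'} M2)) (Im H {z, w} M3 ∪ Im H {x, w'} M3)
  have u3 := card_union_le (Im H {x, w} M1 ∪ Im H {y, w'} M1) (Im H {y, w} M2 ∪
      Im H {z, w'} M2)
  have u4 := card_union_le (Im H {x, w} M1) (Im H {y, w'} M1)
  have u5 := card_union_le (Im H {y, w} M2) (Im H {z, w'} M2)
  have u6 := card_union_le (Im H {z, w} M3) (Im H {x, w'} M3)
  have u7 := card_le_three (a := ({x, w, w'} : Finset ℕ)) (b := {y, w, w'}) (c := {z, w, w'})
  have i1 := Im_card H {x, w} M1
  have i2 := Im_card H {y, w'} M1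
  have i3 := Im_card H {y, w} M2
  have i4 := Im_card H {z, w'} M2
  have i5 := Im_card H {z, w} M3
  have i6 := Im_card H {x, w'} M3
  obtain ⟨m, hm⟩ := Nat.exists_eq_add_of_le hn
  have e : V.card - 1 = m + 7 + 1 := by omega
  have c4 := two_choose (m + 7)
  rw [e]
  have : H.card ≤ 4 * m + 27 := by
    rcases (cov B).eq_empty_or_nonempty with h0 | h0
    · rw [h0, card_empty] at h8
      omega
    · have := h4 h0
      omega
  nlinarith

end CaseII


lemma rot (a i b : ℕ) : (insert a {i, b} : Finset ℕ) = insert b {i, a} := by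
  ext z; simp only [mem_insert, mem_singleton]; tauto

lemma filt3 (H : Finset (Finset ℕ)) (p q r : Finset ℕ) :
    (({p, q, r} : Finset (Finset ℕ)).filter (fun e => e ∈ H)).card ≤ ind H p + ind H q + ind H r := by
  have h1 : ({p, q, r} : Finset (Finset ℕ)).filter (fun e => e ∈ H) ⊆
      (({p} : Finset (Finset ℕ)).filter (fun e => e ∈ H)) ∪
      (({q} : Finset (Finset ℕ)).filter (fun e => e ∈ H)) ∪
      (({r} : Finset (Finset ℕ)).filter (fun e => e ∈ H)) := by
    intro e
    simp only [mem_filter, mem_union, mem_insert, mem_singleton]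
    tauto
  have hs : ∀ p, (({p} : Finset (Finset ℕ)).filter (fun e => e ∈ H)).card = ind H p := by
    intro p
    rw [filter_singleton]
    unfold ind
    split_ifs <;> simp
  have h2 := card_le_card h1
  have h3 := card_union_le ((({p} : Finset (Finset ℕ)).filter (fun e => e ∈ H)) ∪
      (({q} : Finset (Finset ℕ)).filter (fun e => e ∈ H)))
      (({r} : Finset (Finset ℕ)).filter (fun e => e ∈ H))
  have h4 := card_union_le (({p} : Finset (Finset ℕ)).filter (fun e => e ∈ H))
      (({q} : Finset (Finset ℕ)).filter (fun e => e ∈ H))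
  rw [hs, hs] at h4
  rw [hs] at h3
  omega

lemma cpl33 {H : Finset (Finset ℕ)} (free : P4Free H) {X Y R : Finset ℕ}
    (hXY : ∀ i ∈ X, ∀ j ∈ Y, i ≠ j) (hXR : ∀ i ∈ X, i ∉ R) (hYR : ∀ i ∈ Y, i ∉ R)
    (hR : 3 ≤ R.card) {x x' x'' y y' y'' : ℕ} (hx : x ∈ X) (hx' : x' ∈ X) (hx'' : x'' ∈ X)
    (hy : y ∈ Y) (hy' : y' ∈ Y) (hy'' : y'' ∈ Y) (n1 : x ≠ x') (n2 : x ≠ x'') (n3 : x' ≠ x'')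
    (m1 : y ≠ y') (m2 : y ≠ y'') (m3 : y' ≠ y'') :
    ind H (insert x'' {x, y}) + ind H (insert y'' {x, y}) + dg H {x, y} R +
    (ind H (insert x'' {x', y'}) + ind H (insert y'' {x', y'}) + dg H {x', y'} R) ≤ R.card + 3 ∧
    (R.card = 3 → ind H (insert x'' {x, y}) + ind H (insert y'' {x, y}) + dg H {x, y} R +
    (ind H (insert x'' {x', y'}) + ind H (insert y'' {x', y'}) + dg H {x', y'} R) ≤ 5 ∨
    (dg H {x, y} R ≤ 1 ∧ dg H {x', y'} R = 3) ∨ (dg H {x, y} R = 3 ∧ dg H {x', y'} R ≤ 1)) := by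
  have a1 := hXY x hx y hy
  have a2 := hXY x hx y' hy'
  have a3 := hXY x hx y'' hy''
  have a4 := hXY x' hx' y hy
  have a5 := hXY x' hx' y' hy'
  have a6 := hXY x' hx' y'' hy''
  have a7 := hXY x'' hx'' y hy
  have a8 := hXY x'' hx'' y' hy'
  have a9 := hXY x'' hx'' y'' hy''
  have b1 := hXR x hx
  have b2 := hXR x' hx'
  have b3 := hXR x'' hx''
  have b4 := hYR y hy
  have b5 := hYR y' hy'
  have b6 := hYR y'' hy''
  have d1 : x'' ∉ insert y'' R := by simp [*]
  have e1 := dg_insert H {x, y} _ d1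
  have e2 := dg_insert H {x', y'} _ d1
  rw [dg_insert H {x, y} _ b6] at e1
  rw [dg_insert H {x', y'} _ b6] at e2
  have hM : (insert x'' (insert y'' R)).card = R.card + 2 := by
    rw [card_insert_of_notMem d1, card_insert_of_notMem b6]
  have p1 := pair_strong free (P := {x, y}) (Q := {x', y'}) (M := insert x'' (insert y'' R))
    (by simp) (by simp) (by simp [a4, Ne.symm n1, Ne.symm a2, Ne.symm m1])
    (by simp [b1, b4, a7, Ne.symm n2, Ne.symm a3, Ne.symm m2])
    (by simp [b2, b5, a8, Ne.symm n3, Ne.symm a6, Ne.symm m3])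
  have q1 := dg_le H {x, y} R
  have q2 := dg_le H {x', y'} R
  have q3 := ind_le H (insert x'' {x, y})
  have q4 := ind_le H (insert y'' {x, y})
  have q5 := ind_le H (insert x'' {x', y'})
  have q6 := ind_le H (insert y'' {x', y'})
  change dg H {x, y} _ + dg H {x', y'} _ ≤ _ ∨ dg H {x, y} _ ≤ _ ∨ dg H {x', y'} _ ≤ _ ∨
    dg H {x, y} _ ≤ _ ∧ dg H {x', y'} _ ≤ _ at p1
  rw [e1, e2, hM] at p1
  constructor
  · omega
  · intro hR3
    omega

lemma arith31 {m c g b r C0 N : ℕ} (hb : b ≤ 2 * m + 7) (hb3 : 3 ≤ c → b ≤ 3) (hc : c ≤ 4)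
    (hC0 : C0 ≤ c * g) (hg : g ≤ 3) (hr : r ≤ 3 * m + 15) (two : 2 ≤ g → r ≤ 2 * m + 12)
    (three : 3 ≤ g → r ≤ m + 9) (hN : N ≤ 1 + b + (r + 3) + C0) : N ≤ 5 * m + 28 := by
  interval_cases g <;> interval_cases c <;> omega

section CaseIII

variable {V : Finset ℕ} {H A B C : Finset (Finset ℕ)}

set_option maxHeartbeats 1000000 in
lemma case33 (h : Cfg V H A B C) (hn : 9 ≤ V.card) (hA : (core A).card = 3)
    (hB : (core B).card = 3) : H.card ≤ (V.card - 1).choose 2 := by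
  obtain ⟨x0, x1, x2, n01, n02, n12, hx⟩ := card_eq_three.1 hA
  obtain ⟨y0, y1, y2, m01, m02, m12, hy⟩ := card_eq_three.1 hB
  obtain ⟨hA1, hUSA, hcovA⟩ := core3 h.nA h.A3 hA
  obtain ⟨hB1, hUSB, hcovB⟩ := core3 h.nB h.B3 hB
  have h1 : A.card = 1 := by rw [hA1]; simp
  have h2 : B.card = 1 := by rw [hB1]; simp
  have h8 := h.card_le
  rw [hcovA, hcovB, card_empty, h1, h2] at h8
  set X := core A with hX
  set Y := core B with hY
  have dXY : Disjoint X Y := h.coreD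
  obtain ⟨R, hR⟩ : ∃ R, R = V \ (X ∪ Y) := ⟨_, rfl⟩
  have hRc : R.card = V.card - 6 := by
    rw [hR, card_sdiff_of_subset (union_subset h.coreV h.symm.coreV),
      card_union_of_disjoint dXY, hA, hB]
  have X0 : x0 ∈ X := by rw [hx]; simp
  have X1 : x1 ∈ X := by rw [hx]; simp
  have X2 : x2 ∈ X := by rw [hx]; simp
  have Y0 : y0 ∈ Y := by rw [hy]; simp
  have Y1 : y1 ∈ Y := by rw [hy]; simp
  have Y2 : y2 ∈ Y := by rw [hy]; simp
  have hXY : ∀ i ∈ X, ∀ j ∈ Y, i ≠ j := by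
    rintro i hi j hj rfl
    exact disjoint_left.1 dXY hi hj
  have hXR : ∀ i ∈ X, i ∉ R := by
    intro i hi; rw [hR]; simp [hi]
  have hYR : ∀ i ∈ Y, i ∉ R := by
    intro i hi; rw [hR]; simp [hi]
  have hsub : Rg X Y H ⊆ (X.biUnion fun i => Y.biUnion fun j => Im H {i, j} R) ∪
      (Y.biUnion fun j => ({insert x1 {x0, j}, insert x2 {x1, j}, insert x0 {x2, j}} :
        Finset (Finset ℕ)).filter (fun e => e ∈ H)) ∪
      (X.biUnion fun i => ({insert y1 {i, y0}, insert y2 {i, y1}, insert y0 {i, y2}} :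
        Finset (Finset ℕ)).filter (fun e => e ∈ H)) := by
    intro c hc
    obtain ⟨i, hi, j, hj, s, hs, hsi, hsj, hij, hce, hH⟩ := Rg_shape h.hV dXY hc
    by_cases hsR : s ∈ R
    · refine mem_union_left _ (mem_union_left _ ?_)
      rw [mem_biUnion]
      refine ⟨i, hi, ?_⟩
      rw [mem_biUnion]
      exact ⟨j, hj, hce ▸ mem_Im hsR hH⟩
    · have hs' : s ∈ X ∨ s ∈ Y := by
        rw [hR, mem_sdiff, mem_union] at hsR
        by_contra hcon
        exact hsR ⟨hs, hcon⟩
      rcases hs' with hs' | hs'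
      · refine mem_union_left _ (mem_union_right _ ?_)
        rw [mem_biUnion]
        refine ⟨j, hj, ?_⟩
        rw [mem_filter]
        refine ⟨?_, hce ▸ hH⟩
        have e : c = insert i {s, j} := by rw [hce, insert_comm]
        rw [hx] at hi hs'
        simp only [mem_insert, mem_singleton] at hi hs' ⊢
        rcases hi with rfl | rfl | rfl <;> rcases hs' with rfl | rfl | rfl <;>
          first
          | with_reducible exact absurd rfl hsi
          | with_reducible exact Or.inl hce
          | with_reducible exact Or.inl e
          | with_reducible exact Or.inr (Or.inl hce)
          | with_reducible exact Or.inr (Or.inl e)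
          | with_reducible exact Or.inr (Or.inr hce)
          | with_reducible exact Or.inr (Or.inr e)
      · refine mem_union_right _ ?_
        rw [mem_biUnion]
        refine ⟨i, hi, ?_⟩
        rw [mem_filter]
        refine ⟨?_, hce ▸ hH⟩
        have e : c = insert j {i, s} := by
          rw [hce, insert_comm, pair_comm, insert_comm]
        rw [hy] at hj hs'
        simp only [mem_insert, mem_singleton] at hj hs' ⊢
        rcases hj with rfl | rfl | rfl <;> rcases hs' with rfl | rfl | rfl <;>
          first
          | with_reducible exact absurd rfl hsj
          | with_reducible exact Or.inl hce
          | with_reducible exact Or.inl e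
          | with_reducible exact Or.inr (Or.inl hce)
          | with_reducible exact Or.inr (Or.inl e)
          | with_reducible exact Or.inr (Or.inr hce)
          | with_reducible exact Or.inr (Or.inr e)
  have u0 := (card_le_card hsub).trans ((card_union_le _ _).trans
    (Nat.add_le_add_right (card_union_le _ _) _))
  have u1 : (X.biUnion fun i => Y.biUnion fun j => Im H {i, j} R).card ≤
      ∑ i ∈ X, ∑ j ∈ Y, dg H {i, j} R :=
    card_biUnion_le.trans (sum_le_sum fun i _ => card_biUnion_le.trans
      (sum_le_sum fun j _ => Im_card _ _ _))
  have u2 : (Y.biUnion fun j => ({insert x1 {x0, j}, insert x2 {x1, j}, insert x0 {x2, j}} :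
        Finset (Finset ℕ)).filter (fun e => e ∈ H)).card ≤ ∑ j ∈ Y,
        (ind H (insert x1 {x0, j}) + ind H (insert x2 {x1, j}) + ind H (insert x0 {x2, j})) :=
    card_biUnion_le.trans (sum_le_sum fun j _ => filt3 _ _ _ _)
  have u3 : (X.biUnion fun i => ({insert y1 {i, y0}, insert y2 {i, y1}, insert y0 {i, y2}} :
        Finset (Finset ℕ)).filter (fun e => e ∈ H)).card ≤ ∑ i ∈ X,
        (ind H (insert y1 {i, y0}) + ind H (insert y2 {i, y1}) + ind H (insert y0 {i, y2})) :=
    card_biUnion_le.trans (sum_le_sum fun j _ => filt3 _ _ _ _)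
  have sX : ∀ f : ℕ → ℕ, ∑ i ∈ X, f i = f x0 + f x1 + f x2 := by
    intro f
    rw [hx, sum_insert (by simp [n01, n02]), sum_pair n12]; omega
  have sY : ∀ f : ℕ → ℕ, ∑ i ∈ Y, f i = f y0 + f y1 + f y2 := by
    intro f
    rw [hy, sum_insert (by simp [m01, m02]), sum_pair m12]; omega
  rw [sX, sY, sY, sY] at u1
  rw [sY] at u2
  rw [sX] at u3
  have hR3 : 3 ≤ R.card := by omega
  have k1 := cpl33 h.free hXY hXR hYR hR3 X0 X1 X2 Y0 Y1 Y2 n01 n02 n12 m01 m02 m12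
  have k2 := cpl33 h.free hXY hXR hYR hR3 X1 X2 X0 Y1 Y2 Y0 n12 n01.symm n02.symm m12 m01.symm m02.symm
  have k3 := cpl33 h.free hXY hXR hYR hR3 X0 X2 X1 Y0 Y2 Y1 n02 n01 n12.symm m02 m01 m12.symm
  have k4 := cpl33 h.free hXY hXR hYR hR3 X0 X1 X2 Y1 Y2 Y0 n01 n02 n12 m12 m01.symm m02.symm
  have k5 := cpl33 h.free hXY hXR hYR hR3 X1 X2 X0 Y2 Y0 Y1 n12 n01.symm n02.symm m02.symm m12.symm m01
  have k6 := cpl33 h.free hXY hXR hYR hR3 X0 X2 X1 Y1 Y0 Y2 n02 n01 n12.symm m01.symm m12 m02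
  have k7 := cpl33 h.free hXY hXR hYR hR3 X0 X1 X2 Y2 Y0 Y1 n01 n02 n12 m02.symm m12.symm m01
  have k8 := cpl33 h.free hXY hXR hYR hR3 X1 X2 X0 Y0 Y1 Y2 n12 n01.symm n02.symm m01 m02 m12
  have k9 := cpl33 h.free hXY hXR hYR hR3 X0 X2 X1 Y2 Y1 Y0 n02 n01 n12.symm m12.symm m02.symm m01.symm
  have t1 : ∀ j : ℕ, ind H (insert x0 {x1, j}) = ind H (insert x1 {x0, j}) := fun j => by
    rw [insert_comm]
  have t2 : ∀ j : ℕ, ind H (insert x1 {x2, j}) = ind H (insert x2 {x1, j}) := fun j => by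
    rw [insert_comm]
  have t3 : ∀ j : ℕ, ind H (insert x2 {x0, j}) = ind H (insert x0 {x2, j}) := fun j => by
    rw [insert_comm]
  have s1 : ∀ j : ℕ, ind H (insert y0 {j, y1}) = ind H (insert y1 {j, y0}) := fun j => by
    rw [rot]
  have s2 : ∀ j : ℕ, ind H (insert y1 {j, y2}) = ind H (insert y2 {j, y1}) := fun j => by
    rw [rot]
  have s3 : ∀ j : ℕ, ind H (insert y2 {j, y0}) = ind H (insert y0 {j, y2}) := fun j => by
    rw [rot]
  simp only [t1, t2, t3, s1, s2, s3] at k1 k2 k3 k4 k5 k6 k7 k8 k9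
  have tot : 2 * (Rg X Y H).card ≤ 9 * (R.card + 3) := by
    linarith only [k1.1, k2.1, k3.1, k4.1, k5.1, k6.1, k7.1, k8.1, k9.1, u0, u1, u2, u3]
  have tot9 : R.card = 3 → 2 * (Rg X Y H).card ≤ 53 := by
    intro h3
    have l1 := k1.2 h3
    have l2 := k2.2 h3
    have l3 := k3.2 h3
    have g1 := k1.1
    have g2 := k2.1
    have g3 := k3.1
    have g4 := k4.1
    have g5 := k5.1
    have g6 := k6.1
    have g7 := k7.1
    have g8 := k8.1
    have g9 := k9.1
    rw [h3] at g1 g2 g3 g4 g5 g6 g7 g8 g9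
    rcases l1 with l1 | l1
    · linarith only [g1, g2, g3, g4, g5, g6, g7, g8, g9, u0, u1, u2, u3, l1]
    rcases l2 with l2 | l2
    · linarith only [g1, g2, g3, g4, g5, g6, g7, g8, g9, u0, u1, u2, u3, l2]
    rcases l3 with l3 | l3
    · linarith only [g1, g2, g3, g4, g5, g6, g7, g8, g9, u0, u1, u2, u3, l3]
    exfalso
    clear g1 g2 g3 g4 g5 g6 g7 g8 g9 k1 k2 k3 k4 k5 k6 k7 k8 k9 u0 u1 u2 u3
    omega
  clear k1 k2 k3 k4 k5 k6 k7 k8 k9 u0 u1 u2 u3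
  obtain ⟨m, hm⟩ := Nat.exists_eq_add_of_le hn
  have e : V.card - 1 = m + 7 + 1 := by omega
  have c4 := two_choose (m + 7)
  rw [e]
  rcases Nat.eq_zero_or_pos m with rfl | hm0
  · have := tot9 (by omega)
    omega
  · have e2 : R.card = m + 3 := by omega
    rw [e2] at tot
    nlinarith

set_option maxHeartbeats 1000000 in
lemma case31 (h : Cfg V H A B C) (hn : 9 ≤ V.card) (hA : (core A).card = 3)
    (hB : (core B).card = 1) : H.card ≤ (V.card - 1).choose 2 ∨
      ∃ w ∈ V, ∃ a ⊆ V, a.card = 3 ∧ w ∉ a ∧ ∀ e ∈ H, e ≠ a → w ∈ e := by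
  obtain ⟨x, y, z, hxy, hxz, hyz, hx⟩ := card_eq_three.1 hA
  obtain ⟨w, hw⟩ := card_eq_one.1 hB
  obtain ⟨hA1, hUS, hcov⟩ := core3 h.nA h.A3 hA
  have h1 : A.card = 1 := by rw [hA1]; simp
  have h7 := h.card_add
  rw [hUS, hA] at h7
  obtain ⟨a, ha⟩ : ∃ a, a = core A := ⟨_, rfl⟩
  rw [← ha] at hA1 hx hA
  have haV : a ⊆ V := ha ▸ h.coreV
  have hwV : w ∈ V := h.symm.coreV (by rw [hw]; simp)
  have hdj : Disjoint a {w} := by rw [ha, ← hw]; exact h.coreD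
  have hwa : w ∉ a := by simpa using hdj
  have hwB : ∀ b ∈ B, w ∈ b := fun b hb => core_sub hb (by rw [hw]; simp)
  by_cases hex : ∀ e ∈ H, e ≠ a → w ∈ e
  · exact Or.inr ⟨w, hwV, a, haV, hA, hwa, hex⟩
  left
  obtain ⟨C0, hC0⟩ : ∃ C0, C0 = (cov B).biUnion (fun K => Im H K a) := ⟨_, rfl⟩
  have hHsub : ∀ e ∈ H, e = a ∨ e ∈ B ∨ e ∈ Rg a {w} H ∨ e ∈ C0 := by
    intro e he
    rcases h.cover e he with h2 | h2 | h2
    · rw [hA1, mem_singleton] at h2; exact Or.inl h2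
    · exact Or.inr (Or.inl h2)
    · rcases h.classify h2 with h3 | h3 | h3
      · rw [← ha, hw] at h3; exact Or.inr (Or.inr (Or.inl h3))
      · obtain ⟨K, hK, i, hi, rfl⟩ := mem_Ex.1 h3
        rw [← ha] at hi
        rw [hC0, mem_biUnion]
        exact Or.inr (Or.inr (Or.inr ⟨K, hK, mem_Im hi he⟩))
      · rw [hcov] at h3; simp [Ex] at h3
  have hc1 : (cov B).Nonempty := by
    by_contra hcon
    rw [not_nonempty_iff_eq_empty] at hcon
    apply hex
    intro e he hea
    rcases hHsub e he with h2 | h2 | h2 | h2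
    · exact absurd h2 hea
    · exact hwB e h2
    · obtain ⟨_, _, j, hj⟩ := mem_filter.1 h2
      rw [mem_inter, mem_singleton] at hj
      exact hj.2 ▸ hj.1
    · rw [hC0, hcon] at h2; simp at h2
  have hb1 := core1_cov1 h.B3 hw hc1
  have hb3 := core1_cov3 h.nB h.B3 hw
  have hc4 := cov_card h.nB h.B3
  rw [hB] at hc4
  obtain ⟨K, hK, hmax⟩ := exists_max_image (cov B) (fun K => dg H K a) hc1
  have hC0c : C0.card ≤ (cov B).card * dg H K a := by
    rw [hC0]
    exact card_biUnion_le_card_mul _ _ _ fun L hL => (Im_card _ _ _).trans (hmax L hL)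
  obtain ⟨W, hW⟩ : ∃ W, W = V \ insert w a := ⟨_, rfl⟩
  have hWc : W.card = V.card - 4 := by
    rw [hW, card_sdiff_of_subset (insert_subset hwV haV), card_insert_of_notMem hwa, hA]
  have hmemW : ∀ s, s ∈ W → s ≠ w ∧ s ∉ a := by
    intro s hs
    rw [hW, mem_sdiff, mem_insert, not_or] at hs
    exact hs.2
  have hKW : ∀ s ∈ K, s ≠ w ∧ s ∉ a := by
    intro s hs
    refine ⟨fun hsw => cov_not_core hK hs (by rw [hw, hsw]; simp), fun hsa => ?_⟩
    have h2 := (mem_sdiff.1 ((mem_cov.1 hK).1.1 hs)).1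
    rw [ha] at hsa
    exact disjoint_left.1 h.disj (core_sub_US hsa) h2
  have hK2 : K.card = 2 := (mem_cov.1 hK).1.2
  have hr : ∀ i, dg H {i, w} W ≤ dg H {i, w} (W \ K) + 2 := by
    intro i
    have : W.filter (fun s => insert s {i, w} ∈ H) ⊆
        (W \ K).filter (fun s => insert s {i, w} ∈ H) ∪ K := by
      intro s hs
      simp only [mem_filter, mem_union, mem_sdiff] at hs ⊢
      tauto
    have h2 := (card_le_card this).trans (card_union_le _ _)
    rw [hK2] at h2
    exact h2
  have loss : ∀ j ∈ a, ∀ j' ∈ a, ∀ k ∈ a, j ≠ j' → j ≠ k → j' ≠ k → ind H (insert k K) = 1 →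
      ind H (insert j K) = 1 → dg H {j, w} (W \ K) = 0 ∨ dg H {j', w} (W \ K) = 0 := by
    intro j hj j' hj' k hk d1 d2 d3 e1 e2
    by_contra hcon
    push Not at hcon
    obtain ⟨c1, c2⟩ := hcon
    obtain ⟨s, hs⟩ := card_pos.1 (Nat.pos_of_ne_zero c1)
    obtain ⟨s', hs'⟩ := card_pos.1 (Nat.pos_of_ne_zero c2)
    simp only [mem_filter, mem_sdiff] at hs hs'
    have f1 : insert k K ∈ H := by unfold ind at e1; by_contra hc; simp [hc] at e1
    have f2 : insert j K ∈ H := by unfold ind at e2; by_contra hc; simp [hc] at e2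
    obtain ⟨v, hv⟩ := card_pos.1 (show 0 < K.card by omega)
    have hKj : ∀ i ∈ a, i ∉ K := fun i hi hiK => (hKW i hiK).2 hi
    have hwK : w ∉ K := fun hc => (hKW w hc).1 rfl
    have haw : ∀ i ∈ a, i ≠ w := by rintro i hi rfl; exact hwa hi
    have hsa := fun i (hi : i ∈ a) (hsi : s = i) => (hmemW s hs.1.1).2 (hsi ▸ hi)
    have hsa' := fun i (hi : i ∈ a) (hsi : s' = i) => (hmemW s' hs'.1.1).2 (hsi ▸ hi)
    refine h.free.false f1 f2 hs.2 hs'.2 ⟨v, by simp [hv]⟩ ⟨j, by simp⟩ ⟨w, by simp⟩ ?_ ?_ ?_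
    · rw [disjoint_right]
      intro u hu
      simp only [mem_insert, mem_singleton] at hu
      rw [mem_insert, not_or]
      rcases hu with rfl | rfl | rfl
      · exact ⟨hsa k hk, hs.1.2⟩
      · exact ⟨d2, hKj _ hj⟩
      · exact ⟨(haw k hk).symm, hwK⟩
    · rw [disjoint_right]
      intro u hu
      simp only [mem_insert, mem_singleton] at hu
      rw [mem_insert, not_or]
      rcases hu with rfl | rfl | rfl
      · exact ⟨hsa' k hk, hs'.1.2⟩
      · exact ⟨d3, hKj _ hj'⟩
      · exact ⟨(haw k hk).symm, hwK⟩
    · rw [disjoint_right]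
      intro u hu
      simp only [mem_insert, mem_singleton] at hu
      rw [mem_insert, not_or]
      rcases hu with rfl | rfl | rfl
      · exact ⟨hsa' j hj, hs'.1.2⟩
      · exact ⟨d1.symm, hKj _ hj'⟩
      · exact ⟨(haw j hj).symm, hwK⟩
  have xa : x ∈ a := by rw [hx]; simp
  have ya : y ∈ a := by rw [hx]; simp
  have za : z ∈ a := by rw [hx]; simp
  have hRsub : Rg a {w} H ⊆ Im H {x, w} W ∪ Im H {y, w} W ∪ Im H {z, w} W ∪
      {{x, y, w}, {y, z, w}, {x, z, w}} := by
    intro c hc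
    obtain ⟨i, hi, j, hj, s, hs, hsi, hsj, hij, hce, hH⟩ := Rg_shape h.hV hdj hc
    rw [mem_singleton] at hj
    subst hj
    by_cases hsW : s ∈ W
    · have hm := mem_Im hsW hH
      rw [← hce] at hm
      rw [hx] at hi
      simp only [mem_insert, mem_singleton] at hi
      rcases hi with rfl | rfl | rfl <;> simp only [mem_union, hm, true_or, or_true]
    · have hsa : s ∈ a := by
        by_contra hcon
        apply hsW
        rw [hW, mem_sdiff, mem_insert]
        exact ⟨hs, by tauto⟩
      refine mem_union_right _ ?_
      have e : c = insert i {s, j} := by rw [hce, insert_comm]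
      rw [hx] at hi hsa
      simp only [mem_insert, mem_singleton] at hi hsa ⊢
      rcases hi with rfl | rfl | rfl <;> rcases hsa with rfl | rfl | rfl <;>
          first
          | with_reducible exact absurd rfl hsi
          | with_reducible exact Or.inl hce
          | with_reducible exact Or.inl e
          | with_reducible exact Or.inr (Or.inl hce)
          | with_reducible exact Or.inr (Or.inl e)
          | with_reducible exact Or.inr (Or.inr hce)
          | with_reducible exact Or.inr (Or.inr e)
  have hRc : (Rg a {w} H).card ≤ dg H {x, w} W + dg H {y, w} W + dg H {z, w} W + 3 := by
    have u1 := card_le_card hRsub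
    have u2 := card_union_le (Im H {x, w} W ∪ Im H {y, w} W ∪ Im H {z, w} W)
      {{x, y, w}, {y, z, w}, {x, z, w}}
    have u3 := card_union_le (Im H {x, w} W ∪ Im H {y, w} W) (Im H {z, w} W)
    have u4 := card_union_le (Im H {x, w} W) (Im H {y, w} W)
    have u5 := card_le_three (a := ({x, y, w} : Finset ℕ)) (b := {y, z, w}) (c := {x, z, w})
    have i1 := Im_card H {x, w} W
    have i2 := Im_card H {y, w} W
    have i3 := Im_card H {z, w} W
    omega
  have hHc : H.card ≤ 1 + B.card + (Rg a {w} H).card + C0.card := by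
    have : H ⊆ {a} ∪ B ∪ Rg a {w} H ∪ C0 := by
      intro e he
      have := hHsub e he
      simp only [mem_union, mem_singleton]
      tauto
    have u1 := card_le_card this
    have u2 := card_union_le ({a} ∪ B ∪ Rg a {w} H) C0
    have u3 := card_union_le ({a} ∪ B) (Rg a {w} H)
    have u4 := card_union_le {a} B
    rw [card_singleton] at u4
    omega
  have hg : dg H K a = ind H (insert x K) + (ind H (insert y K) + ind H (insert z K)) := by
    rw [hx, dg_insert _ _ _ (by simp [hxy, hxz]), dg_insert _ _ _ (by simp [hyz])]
    have : dg H K {z} = ind H (insert z K) := by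
      have := dg_insert H K ∅ (s := z) (by simp)
      simpa [dg] using this
    rw [this]
  have gx := ind_le H (insert x K)
  have gy := ind_le H (insert y K)
  have gz := ind_le H (insert z K)
  have rx := hr x
  have ry := hr y
  have rz := hr z
  have rx' := dg_le H {x, w} W
  have ry' := dg_le H {y, w} W
  have rz' := dg_le H {z, w} W
  rw [hWc] at rx' ry' rz'
  obtain ⟨m, hm⟩ := Nat.exists_eq_add_of_le hn
  have e : V.card - 1 = m + 7 + 1 := by omega
  have c4 := two_choose (m + 7)
  rw [e]
  have l1 := fun p q => loss x xa y ya z za hxy hxz hyz p q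
  have l2 := fun p q => loss y ya z za x xa hyz hxy.symm hxz.symm p q
  have l3 := fun p q => loss x xa z za y ya hxz hxy hyz.symm p q
  have hb : B.card + 0 ≤ 2 * m + 7 := by omega
  have two : 2 ≤ dg H K a → dg H {x, w} W + dg H {y, w} W + dg H {z, w} W ≤ 2 * m + 12 := by
    intro h2
    have : (ind H (insert x K) = 1 ∧ ind H (insert y K) = 1) ∨
      (ind H (insert x K) = 1 ∧ ind H (insert z K) = 1) ∨
      (ind H (insert y K) = 1 ∧ ind H (insert z K) = 1) := by omega
    rcases this with ⟨a1, a2⟩ | ⟨a1, a2⟩ | ⟨a1, a2⟩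
    · have := l2 a1 a2; omega
    · have := l1 a2 a1; omega
    · have := loss y ya x xa z za hxy.symm hyz hxz a2 a1; omega
  have three : 3 ≤ dg H K a → dg H {x, w} W + dg H {y, w} W + dg H {z, w} W ≤ m + 9 := by
    intro h2
    have q1 : ind H (insert x K) = 1 := by omega
    have q2 : ind H (insert y K) = 1 := by omega
    have q3 : ind H (insert z K) = 1 := by omega
    have := l1 q3 q1
    have := l2 q1 q2
    have := l3 q2 q1
    omega
  have g3 : dg H K a ≤ 3 := by omega
  have hcB : (cov B).card ≤ 4 := by omega
  have fin1 : H.card ≤ 5 * m + 28 :=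
    arith31 (r := dg H {x, w} W + dg H {y, w} W + dg H {z, w} W) (by omega) hb3 hcB hC0c g3
      (by omega) two three (by omega)
  nlinarith

end CaseIII


section BigCov

variable {A : Finset (Finset ℕ)}

lemma core0_disj (nA : A.Nonempty) (h3 : ∀ a ∈ A, a.card = 3) (hc : core A = ∅)
    {T : Finset (Finset ℕ)} (hT : T ⊆ cov A) (ht : 4 ≤ T.card) :
    ∃ K ∈ T, ∃ L ∈ T, Disjoint K L := by
  refine graph_disj (fun K hK => (mem_cov.1 (hT hK)).1.2) (fun x => ?_) ht
  refine (card_le_card (filter_subset_filter _ hT)).trans ?_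
  have := cov_deg nA h3 (x := x) (by rw [hc]; simp)
  omega

lemma core0_pair (nA : A.Nonempty) (h3 : ∀ a ∈ A, a.card = 3) (hc : core A = ∅)
    (ht : 4 ≤ (cov A).card) : A.card + 12 ≤ 4 * (US A).card := by
  obtain ⟨K, hK, L, hL, hd⟩ := core0_disj nA h3 hc Subset.rfl ht
  have hK2 := (mem_cov.1 hK).1
  have hL2 := (mem_cov.1 hL).1
  have hKL : (K ∪ L).card = 4 := by rw [card_union_of_disjoint hd, hK2.2, hL2.2]
  have hU : K ∪ L ⊆ US A := union_subset (hK2.1.trans sdiff_subset) (hL2.1.trans sdiff_subset)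
  have hsub : A ⊆ (K ∪ L).powersetCard 3 ∪
      (K ×ˢ L).biUnion (fun p => (US A \ (K ∪ L)).image (fun s => insert s {p.1, p.2})) := by
    intro a ha
    rw [mem_union]
    by_cases haKL : a ⊆ K ∪ L
    · exact Or.inl (mem_powersetCard.2 ⟨haKL, h3 a ha⟩)
    · right
      obtain ⟨s, hsa, hs⟩ := not_subset.1 haKL
      obtain ⟨i, hi, hia⟩ := cov_hit hK ha
      obtain ⟨j, hj, hja⟩ := cov_hit hL ha
      rw [mem_biUnion]
      refine ⟨(i, j), mem_product.2 ⟨hi, hj⟩, mem_image.2 ⟨s, mem_sdiff.2 ⟨sub_US ha hsa, hs⟩, ?_⟩⟩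
      refine (three_eq (h3 a ha) hsa hia hja ?_ ?_ ?_).symm
      · rintro rfl; exact hs (mem_union_left _ hi)
      · rintro rfl; exact hs (mem_union_right _ hj)
      · rintro rfl; exact disjoint_left.1 hd hi hj
  have h1 := (card_le_card hsub).trans (card_union_le _ _)
  have h2 : ((K ×ˢ L).biUnion (fun p => (US A \ (K ∪ L)).image
      (fun s => (insert s {p.1, p.2} : Finset ℕ)))).card ≤ (K ×ˢ L).card * (US A \ (K ∪ L)).card :=
    card_biUnion_le_card_mul _ _ _ fun p _ => card_image_le
  rw [card_product, hK2.2, hL2.2, card_sdiff_of_subset hU, hKL] at h2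
  rw [card_powersetCard, hKL] at h1
  have h4 : Nat.choose 4 3 = 4 := rfl
  have h5 := card_le_card hU
  omega

lemma core0_big (nA : A.Nonempty) (h3 : ∀ a ∈ A, a.card = 3) (hc : core A = ∅)
    (ht : 7 ≤ (cov A).card) : A.card ≤ 8 ∧ (8 ≤ (cov A).card → A.card ≤ 4) := by
  obtain ⟨K, hK, L, hL, hd⟩ := core0_disj nA h3 hc Subset.rfl (by omega)
  have hK2 := (mem_cov.1 hK).1
  have hL2 := (mem_cov.1 hL).1
  have hsub : A ⊆ (K ×ˢ L).biUnion (fun p => A.filter (fun a => p.1 ∈ a ∧ p.2 ∈ a)) := by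
    intro a ha
    obtain ⟨i, hi, hia⟩ := cov_hit hK ha
    obtain ⟨j, hj, hja⟩ := cov_hit hL ha
    rw [mem_biUnion]
    exact ⟨(i, j), mem_product.2 ⟨hi, hj⟩, mem_filter.2 ⟨ha, hia, hja⟩⟩
  have hrem : ∀ i j, (cov A).card ≤ ((cov A).filter (fun M => i ∉ M ∧ j ∉ M)).card + 6 := by
    intro i j
    have h1 := cov_deg nA h3 (x := i) (by rw [hc]; simp)
    have h2 := cov_deg nA h3 (x := j) (by rw [hc]; simp)
    have : cov A ⊆ (cov A).filter (fun M => i ∉ M ∧ j ∉ M) ∪ (cov A).filter (fun M => i ∈ M) ∪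
        (cov A).filter (fun M => j ∈ M) := by
      intro M hM
      simp only [mem_union, mem_filter]
      tauto
    have h4 := (card_le_card this).trans ((card_union_le _ _).trans
      (Nat.add_le_add_right (card_union_le _ _) _))
    omega
  have hF : ∀ i ∈ K, ∀ j ∈ L, ∀ M ∈ cov A, i ∉ M → j ∉ M →
      A.filter (fun a => i ∈ a ∧ j ∈ a) ⊆ M.image (fun v => {i, j, v}) := by
    intro i hi j hj M hM hiM hjM a ha
    rw [mem_filter] at ha
    obtain ⟨v, hv, hva⟩ := cov_hit hM ha.1
    refine mem_image.2 ⟨v, hv, (three_eq (h3 a ha.1) ha.2.1 ha.2.2 hva ?_ ?_ ?_).symm⟩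
    · rintro rfl; exact disjoint_left.1 hd hi hj
    · rintro rfl; exact hiM hv
    · rintro rfl; exact hjM hv
  constructor
  · have : ((K ×ˢ L).biUnion (fun p => A.filter (fun a => p.1 ∈ a ∧ p.2 ∈ a))).card ≤
        (K ×ˢ L).card * 2 := by
      refine card_biUnion_le_card_mul _ _ _ fun p hp => ?_
      rw [mem_product] at hp
      obtain ⟨M, hM⟩ := card_pos.1 (show 0 < ((cov A).filter (fun M => p.1 ∉ M ∧ p.2 ∉ M)).card by
        have := hrem p.1 p.2; omega)
      rw [mem_filter] at hM
      refine (card_le_card (hF _ hp.1 _ hp.2 M hM.1 hM.2.1 hM.2.2)).trans (card_image_le.trans ?_)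
      rw [(mem_cov.1 hM.1).1.2]
    rw [card_product, hK2.2, hL2.2] at this
    exact (card_le_card hsub).trans this
  · intro h8
    have : ((K ×ˢ L).biUnion (fun p => A.filter (fun a => p.1 ∈ a ∧ p.2 ∈ a))).card ≤
        (K ×ˢ L).card * 1 := by
      refine card_biUnion_le_card_mul _ _ _ fun p hp => ?_
      rw [mem_product] at hp
      obtain ⟨M, hM, N, hN, hMN⟩ := one_lt_card.1
        (show 1 < ((cov A).filter (fun M => p.1 ∉ M ∧ p.2 ∉ M)).card by
          have := hrem p.1 p.2; omega)
      rw [mem_filter] at hM hN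
      have hsub' : A.filter (fun a => p.1 ∈ a ∧ p.2 ∈ a) ⊆
          (M ∩ N).image (fun v => {p.1, p.2, v}) := by
        intro a ha
        obtain ⟨v, hv, rfl⟩ := mem_image.1 (hF _ hp.1 _ hp.2 M hM.1 hM.2.1 hM.2.2 ha)
        obtain ⟨u, hu, hua⟩ := cov_hit hN.1 (mem_filter.1 ha).1
        simp only [mem_insert, mem_singleton] at hua
        refine mem_image.2 ⟨v, mem_inter.2 ⟨hv, ?_⟩, rfl⟩
        rcases hua with rfl | rfl | rfl
        · exact absurd hu hN.2.1
        · exact absurd hu hN.2.2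
        · exact hu
      refine (card_le_card hsub').trans (card_image_le.trans ?_)
      by_contra hcon
      apply hMN
      have m2 := (mem_cov.1 hM.1).1.2
      have n2 := (mem_cov.1 hN.1).1.2
      have e1 : M ∩ N = M := eq_of_subset_of_card_le inter_subset_left (by omega)
      have e2 : M ∩ N = N := eq_of_subset_of_card_le inter_subset_right (by omega)
      rw [← e1, e2]
    rw [card_product, hK2.2, hL2.2] at this
    exact (card_le_card hsub).trans this

lemma cov_miss (h3 : ∀ a ∈ A, a.card = 3) (ht : (cov A).Nonempty) :
    A.card + ((US A).card - 2).choose 3 ≤ (US A).card.choose 3 := by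
  obtain ⟨K, hK⟩ := ht
  have hK2 := (mem_cov.1 hK).1
  have hKU : K ⊆ US A := hK2.1.trans sdiff_subset
  have hd : Disjoint A ((US A \ K).powersetCard 3) := by
    rw [disjoint_left]
    intro a ha ha'
    obtain ⟨v, hv, hva⟩ := cov_hit hK ha
    exact (mem_sdiff.1 ((mem_powersetCard.1 ha').1 hva)).2 hv
  have e : ((US A \ K).powersetCard 3).card = ((US A).card - 2).choose 3 := by
    rw [card_powersetCard, card_sdiff_of_subset hKU, hK2.2]
  rw [← e, ← card_union_of_disjoint hd, ← card_powersetCard]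
  apply card_le_card
  apply union_subset
  · intro a ha
    exact mem_powersetCard.2 ⟨sub_US ha, h3 a ha⟩
  · exact powersetCard_mono sdiff_subset

end BigCov

/-- Upper bound for order m. -/
def Bd (m : ℕ) : Prop := ∀ V : Finset ℕ, ∀ H : Finset (Finset ℕ),
  V.card = m → ThreeGraphOn V H → P4Free H → H.card ≤ (m - 1).choose 2 + 1

lemma P4Free.mono {H H' : Finset (Finset ℕ)} (h : P4Free H) (hs : H' ⊆ H) : P4Free H' := by
  rintro ⟨a, ha, b, hb, c, hc, d, hd, hp⟩
  exact h ⟨a, hs ha, b, hs hb, c, hs hc, d, hs hd, hp⟩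

lemma deg_reduce {V : Finset ℕ} {H : Finset (Finset ℕ)} (hV : ThreeGraphOn V H) (free : P4Free H)
    (hn : 10 ≤ V.card) (hB : Bd (V.card - 1)) {v : ℕ} (hv : v ∈ V)
    (hd : (H.filter (fun e => v ∈ e)).card ≤ V.card - 3) : H.card ≤ (V.card - 1).choose 2 := by
  have h1 := hB (V.erase v) (H.filter (fun e => ¬ v ∈ e)) (card_erase_of_mem hv) (by
    intro e he
    rw [mem_filter] at he
    refine ⟨fun x hx => mem_erase.2 ⟨?_, (hV e he.1).1 hx⟩, (hV e he.1).2⟩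
    rintro rfl
    exact he.2 hx) (free.mono (filter_subset _ _))
  have h2 := Finset.card_filter_add_card_filter_not (s := H) (fun e => v ∈ e)
  obtain ⟨m, hm⟩ := Nat.exists_eq_add_of_le hn
  have e1 : V.card - 1 - 1 = m + 8 := by omega
  have e2 : V.card - 1 = m + 8 + 1 := by omega
  rw [e1] at h1
  have h5 : (m + 8 + 1).choose 2 = (m + 8) + (m + 8).choose 2 := by
    rw [Nat.choose_succ_succ' (m + 8) 1, Nat.choose_one_right]
  rw [e2]
  omega

section CaseZ

variable {V : Finset ℕ} {H A B C : Finset (Finset ℕ)}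

lemma Cfg.shape0 (h : Cfg V H A B C) (hA : core A = ∅) : ∀ e ∈ H, e ∈ A ∨ e ∈ B ∨
    e ∈ (cov A).biUnion (fun K => Im H K (core B)) := by
  intro e he
  rcases h.cover e he with h2 | h2 | h2
  · exact Or.inl h2
  · exact Or.inr (Or.inl h2)
  · obtain ⟨y, hy, K, hK, rfl⟩ := h.classify1 h2 (by rw [hA]; simp)
    exact Or.inr (Or.inr (mem_biUnion.2 ⟨K, hK, mem_Im hy he⟩))

lemma Cfg.card0 (h : Cfg V H A B C) (hA : core A = ∅) : H.card ≤ A.card + B.card +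
    ∑ K ∈ cov A, dg H K (core B) := by
  have : H ⊆ A ∪ B ∪ (cov A).biUnion (fun K => Im H K (core B)) := by
    intro e he
    rw [mem_union, mem_union, or_assoc]
    exact h.shape0 hA e he
  have h1 := (card_le_card this).trans ((card_union_le _ _).trans
    (Nat.add_le_add_right (card_union_le _ _) _))
  have h2 : ((cov A).biUnion (fun K => Im H K (core B))).card ≤ ∑ K ∈ cov A, dg H K (core B) :=
    card_biUnion_le.trans (sum_le_sum fun K _ => Im_card _ _ _)
  omega

lemma Cfg.sum0 (h : Cfg V H A B C) (T : Finset (Finset ℕ)) :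
    ∑ K ∈ T, dg H K (core B) ≤ T.card * (core B).card := by
  rw [← smul_eq_mul]
  exact sum_le_card_nsmul _ _ _ fun K _ => dg_le _ _ _

lemma caseZ10 (h : Cfg V H A B C) (hn : 10 ≤ V.card) (hBd : Bd (V.card - 1)) (hA : core A = ∅)
    (hB : (core B).Nonempty) : H.card ≤ (V.card - 1).choose 2 := by
  obtain ⟨w, hw⟩ := hB
  have hp := US_card_ge4 h.nA h.A3 (by rw [hA]; simp)
  have hq := h.card_add
  have hYB : core B ⊆ US B := core_sub_US
  have hb3 := core_card_le h.nB h.B3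
  have hdj := disjoint_left.1 h.disj
  have hKA : ∀ K ∈ cov A, ∀ v ∈ K, v ∈ US A := fun K hK v hv =>
    (mem_sdiff.1 ((mem_cov.1 hK).1.1 hv)).1
  by_cases hB3 : (core B).card = 3
  · obtain ⟨hB1, hUSB, -⟩ := core3 h.nB h.B3 hB3
    by_cases ht : (cov A).card + 1 ≤ V.card - 3
    · refine deg_reduce h.hV h.free hn hBd (h.symm.USV (hYB hw)) (le_trans ?_ ht)
      have : H.filter (fun e => w ∈ e) ⊆ (cov A).image (fun K => insert w K) ∪ {core B} := by
        intro e he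
        rw [mem_filter] at he
        rw [mem_union]
        rcases h.shape0 hA e he.1 with h1 | h1 | h1
        · exact absurd (hYB hw) (hdj (sub_US h1 he.2))
        · rw [hB1] at h1; exact Or.inr h1
        · left
          obtain ⟨K, hK, h2⟩ := mem_biUnion.1 h1
          obtain ⟨y, hy, rfl⟩ := mem_image.1 h2
          rcases mem_insert.1 he.2 with rfl | h3
          · exact mem_image.2 ⟨K, hK, rfl⟩
          · exact absurd (hYB hw) (hdj (hKA K hK _ h3))
      have h1 := (card_le_card this).trans (card_union_le _ _)
      rw [card_singleton] at h1
      have h2 := card_image_le (s := cov A) (f := fun K => insert w K)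
      omega
    · have h1 := core0_big h.nA h.A3 hA (by omega)
      have h2 := h.card0 hA
      have h3 := h.sum0 (cov A)
      have h4 := cov_card h.nA h.A3
      rw [hA, card_empty] at h4
      have h5 : B.card = 1 := by rw [hB1]; simp
      rw [hB3] at h3
      obtain ⟨m, hm⟩ := Nat.exists_eq_add_of_le hn
      have e2 : V.card - 1 = m + 8 + 1 := by omega
      have := two_choose (m + 8)
      rw [e2]
      nlinarith
  · have hq4 := US_card_ge4 h.nB h.B3 (by omega)
    obtain ⟨v, hv, hvw⟩ := exists_mem_notMem_of_card_lt_card (s := core B) (t := US B) (by omega)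
    refine deg_reduce h.hV h.free hn hBd (h.symm.USV hv) ?_
    have hwv : w ≠ v := by rintro rfl; exact hvw hw
    have : H.filter (fun e => v ∈ e) ⊆ (US B \ {w, v}).image (fun s => insert s {w, v}) := by
      intro e he
      rw [mem_filter] at he
      rcases h.shape0 hA e he.1 with h1 | h1 | h1
      · exact absurd hv (hdj (sub_US h1 he.2))
      · obtain ⟨s, hs, hse, he'⟩ := three_insert (P := {w, v}) (h.B3 e h1) (card_pair hwv) (by
          intro z hz
          simp only [mem_insert, mem_singleton] at hz
          rcases hz with rfl | rfl
          · exact core_sub h1 hw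
          · exact he.2)
        exact mem_image.2 ⟨s, mem_sdiff.2 ⟨sub_US h1 hse, hs⟩, he'.symm⟩
      · obtain ⟨K, hK, h2⟩ := mem_biUnion.1 h1
        obtain ⟨y, hy, rfl⟩ := mem_image.1 h2
        rcases mem_insert.1 he.2 with rfl | h3
        · exact absurd (mem_filter.1 hy).1 hvw
        · exact absurd hv (hdj (hKA K hK _ h3))
    refine (card_le_card this).trans (card_image_le.trans ?_)
    rw [card_sdiff_of_subset, card_pair hwv]
    · omega
    · intro z hz
      simp only [mem_insert, mem_singleton] at hz
      rcases hz with rfl | rfl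
      · exact hYB hw
      · exact hv

lemma choose_bd {p k : ℕ} (hk : p ≤ k) {a : ℕ} (h : a ≤ p.choose 3) : a ≤ k.choose 3 :=
  h.trans (Nat.choose_le_choose 3 hk)

lemma caseZ9 (h : Cfg V H A B C) (hn : V.card = 9) (hA : core A = ∅)
    (hB : (core B).Nonempty) : H.card ≤ (V.card - 1).choose 2 := by
  have hb0 := card_pos.2 hB
  have hp := US_card_ge4 h.nA h.A3 (by rw [hA]; simp)
  have hq := h.card_add
  have hb3 := core_card_le h.nB h.B3
  have h2 := h.card0 hA
  have h3 := h.sum0 (cov A)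
  have h4 := cov_card h.nA h.A3
  rw [hA, card_empty] at h4
  have h5 := card_le_choose h.A3
  have h6 := fun p => core0_big h.nA h.A3 hA p
  have e28 : (V.card - 1).choose 2 = 28 := by rw [hn]; rfl
  rw [e28]
  have c5 : Nat.choose 5 3 = 10 := rfl
  have c6 : Nat.choose 6 3 = 20 := rfl
  have hb : (core B).card = 1 ∨ (core B).card = 2 ∨ (core B).card = 3 := by omega
  rcases hb with hb | hb | hb
  · obtain ⟨w, hw⟩ := card_eq_one.1 hb
    have hq4 := US_card_ge4 h.nB h.B3 (by omega)
    have h7 := core1_card h.B3 hw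
    have h8 := h7.trans (Nat.choose_le_choose 2 (show (US B).card - 1 ≤ 4 by omega))
    have h9 := choose_bd (show (US A).card ≤ 5 by omega) h5
    have c4 : Nat.choose 4 2 = 6 := rfl
    rw [hb] at h3
    omega
  · have hq4 := US_card_ge4 h.nB h.B3 (by omega)
    have h7 := core2_card h.B3 hb
    have h9 := choose_bd (show (US A).card ≤ 5 by omega) h5
    rw [hb] at h3
    by_cases ht : 8 ≤ (cov A).card
    · have := (h6 (by omega)).2 ht
      omega
    · omega
  · obtain ⟨hB1, hUSB, -⟩ := core3 h.nB h.B3 hb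
    have hBc : B.card = 1 := by rw [hB1]; simp
    rw [hUSB, hb] at hq
    have h9 := choose_bd (show (US A).card ≤ 6 by omega) h5
    rw [hb] at h3
    have hKd : ∀ K ∈ cov A, Disjoint K (core B) := fun K hK =>
      disjoint_of_subset_left ((mem_cov.1 hK).1.1.trans sdiff_subset)
        (disjoint_of_subset_right core_sub_US h.disj)
    have hKn : ∀ K ∈ cov A, K.Nonempty := fun K hK => by
      rw [← card_pos, (mem_cov.1 hK).1.2]; omega
    have pl : ∀ K ∈ cov A, ∀ L ∈ cov A, Disjoint K L → dg H K (core B) + dg H L (core B) ≤ 4 := by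
      intro K hK L hL hd
      have := pair_lemma h.free (hKn K hK) (hKn L hL) hd (hKd K hK) (hKd L hL) (by omega)
      rw [hb] at this
      exact this
    have split : ∀ T ⊆ cov A, ∀ K ∈ T, ∀ L ∈ T, Disjoint K L → (T \ {K, L}).card + 2 = T.card ∧
        ∑ M ∈ T, dg H M (core B) ≤ ∑ M ∈ T \ {K, L}, dg H M (core B) + 4 := by
      intro T hT K hK L hL hd
      have hKL : K ≠ L := by
        rintro rfl
        rw [disjoint_self_iff_empty] at hd
        exact (hKn K (hT hK)).ne_empty hd
      have hs : ({K, L} : Finset (Finset ℕ)) ⊆ T := by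
        intro M hM
        simp only [mem_insert, mem_singleton] at hM
        rcases hM with rfl | rfl <;> assumption
      have e1 := card_sdiff_add_card_eq_card hs
      rw [card_pair hKL] at e1
      refine ⟨e1, ?_⟩
      have e2 := sum_sdiff hs (f := fun M => dg H M (core B))
      rw [sum_pair hKL] at e2
      have := pl K (hT hK) L (hT hL) hd
      omega
    by_cases t4 : 4 ≤ (cov A).card
    · have a12 := core0_pair h.nA h.A3 hA t4
      obtain ⟨K, hK, L, hL, hd⟩ := core0_disj h.nA h.A3 hA Subset.rfl t4
      obtain ⟨s1, s2⟩ := split _ Subset.rfl K hK L hL hd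
      have s3 := h.sum0 (cov A \ {K, L})
      rw [hb] at s3
      by_cases t6 : 6 ≤ (cov A).card
      · obtain ⟨K', hK', L', hL', hd'⟩ := core0_disj h.nA h.A3 hA
          (T := cov A \ {K, L}) sdiff_subset (by omega)
        obtain ⟨s1', s2'⟩ := split _ sdiff_subset K' hK' L' hL' hd'
        have s3' := h.sum0 ((cov A \ {K, L}) \ {K', L'})
        rw [hb] at s3'
        by_cases t8 : 8 ≤ (cov A).card
        · have := (h6 (by omega)).2 t8
          omega
        by_cases t7 : 7 ≤ (cov A).card
        · have := (h6 t7).1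
          omega
        · omega
      · omega
    · by_cases t3 : 3 ≤ (cov A).card
      · have := cov_miss h.A3 (card_pos.1 (by omega))
        have : A.card ≤ 16 := by
          by_cases hp6 : (US A).card = 6
          · rw [hp6] at this
            have c4 : Nat.choose (6 - 2) 3 = 4 := rfl
            omega
          · have := choose_bd (show (US A).card ≤ 5 by omega) h5
            omega
        omega
      · omega

lemma Cfg.bdA (h : Cfg V H A B C) (hn : 10 ≤ V.card)
    (ih : ∀ m, 9 ≤ m → m < V.card → Bd m) : (9 ≤ (US A).card → A.card ≤ ((US A).card - 1).choose 2 + 1)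
      ∧ ((US A).card ≤ 8 → A.card ≤ 29) := by
  have hfree := h.free.mono h.hA
  have hcard := h.card_add
  have hB := US_card_ge h.nB h.B3
  constructor
  · intro h9
    exact ih _ h9 (by omega) (US A) A rfl (fun a ha => ⟨sub_US ha, h.A3 a ha⟩) hfree
  · intro h8
    obtain ⟨U, hAU, -, hU⟩ := exists_subsuperset_card_eq h.USV (show (US A).card ≤ 9 by omega)
      (by omega)
    exact ih 9 le_rfl (by omega) U A hU (fun a ha => ⟨(sub_US ha).trans hAU, h.A3 a ha⟩) hfree

lemma case00 (h : Cfg V H A B C) (hn : 9 ≤ V.card)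
    (ih : ∀ m, 9 ≤ m → m < V.card → Bd m) (hA : core A = ∅) (hB : core B = ∅) :
    H.card ≤ (V.card - 1).choose 2 := by
  have h2 := h.card0 hA
  have h3 := h.sum0 (cov A)
  rw [hB, card_empty, mul_zero] at h3
  rw [hB] at h2
  have h5 := card_le_choose h.A3
  have h6 := card_le_choose h.B3
  have hp := US_card_ge4 h.nA h.A3 (by rw [hA]; simp)
  have hq := US_card_ge4 h.nB h.B3 (by rw [hB]; simp)
  have h7 := h.card_add
  have hH : H.card ≤ A.card + B.card := by omega
  clear h2 h3
  rcases Nat.lt_or_ge V.card 10 with h9 | h10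
  · have h9 : V.card = 9 := by omega
    rw [h9]
    have a5 := choose_bd (show (US A).card ≤ 5 by omega) h5
    have b5 := choose_bd (show (US B).card ≤ 5 by omega) h6
    have c5 : Nat.choose 5 3 = 10 := rfl
    have c8 : Nat.choose (9 - 1) 2 = 28 := rfl
    omega
  obtain ⟨a9, a8⟩ := h.bdA h10 ih
  obtain ⟨b9, b8⟩ := h.symm.bdA h10 ih
  generalize (US A).card = p at *
  generalize (US B).card = q at *
  generalize A.card = x at *
  generalize B.card = y at *
  generalize H.card = z at *
  generalize V.card = n at *
  have mixed : ∀ p q x y : ℕ, 4 ≤ p → p ≤ 8 → 9 ≤ q → p + q ≤ n → x ≤ 29 →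
      y ≤ (q - 1).choose 2 + 1 → x + y ≤ (n - 1).choose 2 := by
    intro p q x y h1 h2 h3 h4 h5 h6
    obtain ⟨Q, rfl⟩ := Nat.exists_eq_add_of_le h3
    obtain ⟨r, rfl⟩ := Nat.exists_eq_add_of_le (show Q + 13 ≤ n by omega)
    have e1 : 9 + Q - 1 = Q + 7 + 1 := by omega
    have e2 : Q + 13 + r - 1 = Q + r + 11 + 1 := by omega
    rw [e1] at h6
    rw [e2]
    have := two_choose (Q + 7)
    have := two_choose (Q + r + 11)
    nlinarith [Nat.zero_le (Q * r), Nat.zero_le (r * r)]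
  rcases Nat.lt_or_ge p 9 with hp9 | hp9
  · rcases Nat.lt_or_ge q 9 with hq9 | hq9
    · have := a8 (by omega)
      have := b8 (by omega)
      rcases Nat.lt_or_ge n 13 with hn13 | hn13
      · have c10 : Nat.choose 9 2 = 36 := rfl
        have c11 : Nat.choose 10 2 = 45 := rfl
        have c12 : Nat.choose 11 2 = 55 := rfl
        have cmono := Nat.choose_le_choose 2 (show p + q - 1 ≤ n - 1 by omega)
        have cmono' := Nat.choose_le_choose 2 (show 9 ≤ n - 1 by omega)
        have d4 : Nat.choose 4 3 = 4 := rfl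
        have d5 : Nat.choose 5 3 = 10 := rfl
        have d6 : Nat.choose 6 3 = 20 := rfl
        have d7 : Nat.choose 7 3 = 35 := rfl
        interval_cases p <;> interval_cases q <;> norm_num at * <;> omega
      · have := Nat.choose_le_choose 2 (show 12 ≤ n - 1 by omega)
        have c12 : Nat.choose 12 2 = 66 := rfl
        omega
    · exact hH.trans (mixed p q x y hp (by omega) hq9 h7 (a8 (by omega)) (b9 hq9))
  · rcases Nat.lt_or_ge q 9 with hq9 | hq9
    · have := mixed q p y x hq (by omega) hp9 (by omega) (b8 (by omega)) (a9 hp9)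
      omega
    · have a := a9 hp9
      have b := b9 hq9
      obtain ⟨P, rfl⟩ := Nat.exists_eq_add_of_le hp9
      obtain ⟨Q, rfl⟩ := Nat.exists_eq_add_of_le hq9
      obtain ⟨r, rfl⟩ := Nat.exists_eq_add_of_le h7
      have e1 : 9 + Q - 1 = Q + 7 + 1 := by omega
      have e2 : 9 + P - 1 = P + 7 + 1 := by omega
      have e3 : 9 + P + (9 + Q) + r - 1 = P + Q + r + 16 + 1 := by omega
      rw [e1] at b
      rw [e2] at a
      rw [e3]
      have := two_choose (Q + 7)
      have := two_choose (P + 7)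
      have := two_choose (P + Q + r + 16)
      nlinarith [Nat.zero_le (P * Q), Nat.zero_le (P * r), Nat.zero_le (Q * r),
        Nat.zero_le (r * r)]

end CaseZ


def Dich (V : Finset ℕ) (H : Finset (Finset ℕ)) : Prop :=
  H.card ≤ (V.card - 1).choose 2 ∨
    ∃ w ∈ V, ∃ a ⊆ V, a.card = 3 ∧ w ∉ a ∧ ∀ e ∈ H, e ≠ a → w ∈ e

lemma cfg_zero {V : Finset ℕ} {H A B C : Finset (Finset ℕ)} (h : Cfg V H A B C) (hn : 9 ≤ V.card)
    (ih : ∀ m, 9 ≤ m → m < V.card → Bd m) (hA : (core A).card = 0) :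
    H.card ≤ (V.card - 1).choose 2 := by
  have hA0 := card_eq_zero.1 hA
  rcases (core B).eq_empty_or_nonempty with hB | hB
  · exact case00 h hn ih hA0 hB
  · rcases Nat.lt_or_ge 9 V.card with h9 | h9
    · exact caseZ10 h h9 (ih _ (by omega) (by omega)) hA0 hB
    · exact caseZ9 h (by omega) hA0 hB

lemma cfg_step {V : Finset ℕ} {H A B C : Finset (Finset ℕ)} (h : Cfg V H A B C) (hn : 9 ≤ V.card)
    (ih : ∀ m, 9 ≤ m → m < V.card → Bd m) : Dich V H := by
  have hA := core_card_le h.nA h.A3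
  have hB := core_card_le h.nB h.B3
  have hA' : (core A).card = 0 ∨ (core A).card = 1 ∨ (core A).card = 2 ∨ (core A).card = 3 := by
    omega
  have hB' : (core B).card = 0 ∨ (core B).card = 1 ∨ (core B).card = 2 ∨ (core B).card = 3 := by
    omega
  rcases hA' with a | a | a | a
  · exact Or.inl (cfg_zero h hn ih a)
  · rcases hB' with b | b | b | b
    · exact Or.inl (cfg_zero h.symm hn ih b)
    · exact Or.inl (case11 h hn a b)
    · exact Or.inl (case21 h.symm hn b a)
    · exact case31 h.symm hn b a
  · rcases hB' with b | b | b | b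
    · exact Or.inl (cfg_zero h.symm hn ih b)
    · exact Or.inl (case21 h hn a b)
    · exact Or.inl (case22 h hn a b)
    · exact Or.inl (case32 h.symm hn b a)
  · rcases hB' with b | b | b | b
    · exact Or.inl (cfg_zero h.symm hn ih b)
    · exact case31 h hn a b
    · exact Or.inl (case32 h hn a b)
    · exact Or.inl (case33 h hn a b)

lemma dich_of {V : Finset ℕ} {H : Finset (Finset ℕ)} (hV : ThreeGraphOn V H) (free : P4Free H)
    (hn : 9 ≤ V.card) (ih : ∀ m, 9 ≤ m → m < V.card → Bd m) : Dich V H := by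
  by_cases hd : ∃ a ∈ H, ∃ b ∈ H, Disjoint a b
  · obtain ⟨A, B, C, h⟩ := exists_cfg hV free hd
    exact cfg_step h hn ih
  · exact Or.inl (intersecting_bound hn rfl hV hd)

lemma star_card {V : Finset ℕ} {v : ℕ} (hv : v ∈ V) :
    ((V.powersetCard 3).filter (fun t => v ∈ t)).card = (V.card - 1).choose 2 := by
  rw [← card_erase_of_mem hv, ← card_powersetCard]
  symm
  refine card_bij (fun s _ => insert v s) ?_ ?_ ?_
  · intro s hs
    rw [mem_powersetCard] at hs
    have hvs : v ∉ s := fun h => (mem_erase.1 (hs.1 h)).1 rfl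
    rw [mem_filter, mem_powersetCard]
    refine ⟨⟨?_, ?_⟩, mem_insert_self _ _⟩
    · exact insert_subset hv (hs.1.trans (erase_subset _ _))
    · rw [card_insert_of_notMem hvs, hs.2]
  · intro s hs t ht hst
    rw [mem_powersetCard] at hs ht
    have hvs : v ∉ s := fun h => (mem_erase.1 (hs.1 h)).1 rfl
    have hvt : v ∉ t := fun h => (mem_erase.1 (ht.1 h)).1 rfl
    have := congrArg (fun u => Finset.erase u v) hst
    simpa [erase_insert hvs, erase_insert hvt] using this
  · intro t ht
    rw [mem_filter, mem_powersetCard] at ht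
    refine ⟨t.erase v, ?_, insert_erase ht.2⟩
    rw [mem_powersetCard, card_erase_of_mem ht.2, ht.1.2]
    exact ⟨erase_subset_erase _ ht.1.1, rfl⟩

lemma starplus_card {V : Finset ℕ} {v : ℕ} {e : Finset ℕ} (hv : v ∈ V) (he : v ∉ e) :
    ((V.powersetCard 3).filter (fun t => v ∈ t) ∪ {e}).card = (V.card - 1).choose 2 + 1 := by
  rw [card_union_of_disjoint, star_card hv, card_singleton]
  rw [disjoint_singleton_right, mem_filter]
  exact fun h => he h.2

lemma dich_sub {V : Finset ℕ} {H : Finset (Finset ℕ)} (hV : ThreeGraphOn V H) {w : ℕ}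
    {a : Finset ℕ} (h : ∀ e ∈ H, e ≠ a → w ∈ e) :
    H ⊆ (V.powersetCard 3).filter (fun t => w ∈ t) ∪ {a} := by
  intro e he
  rw [mem_union, mem_singleton, mem_filter, mem_powersetCard]
  by_cases hea : e = a
  · exact Or.inr hea
  · exact Or.inl ⟨hV e he, h e he hea⟩

lemma bd_all : ∀ n, 9 ≤ n → Bd n := by
  intro n
  induction n using Nat.strong_induction_on with
  | _ n ih =>
    intro hn V H hc hV free
    subst hc
    rcases dich_of hV free hn (fun m h9 hm => ih m hm h9) with h | ⟨w, hw, a, ha, ha3, hwa, h⟩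
    · omega
    · rw [← starplus_card hw hwa]
      exact card_le_card (dich_sub hV h)

lemma starplus_free {V : Finset ℕ} {v : ℕ} {e : Finset ℕ} :
    P4Free ((V.powersetCard 3).filter (fun t => v ∈ t) ∪ {e}) := by
  rintro ⟨a, ha, b, hb, c, hc, d, hd, hab, hbc, hcd, hac, had, hbd⟩
  have key : ∀ x ∈ ((V.powersetCard 3).filter (fun t => v ∈ t) ∪ {e}), v ∈ x ∨ x = e := by
    intro x hx
    rw [mem_union, mem_singleton, mem_filter] at hx
    exact hx.imp And.right id
  have k2 : ∀ x y : Finset ℕ, x ∩ y = ∅ → (v ∈ x ∨ x = e) → (v ∈ y ∨ y = e) → x = e ∨ y = e := by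
    intro x y hxy hx hy
    rcases hx with hx | hx
    · rcases hy with hy | hy
      · have : v ∈ x ∩ y := mem_inter.2 ⟨hx, hy⟩
        rw [hxy] at this
        exact absurd this (notMem_empty v)
      · exact Or.inr hy
    · exact Or.inl hx
  have q1 := k2 a c hac (key a ha) (key c hc)
  have q2 := k2 b d hbd (key b hb) (key d hd)
  have q3 := k2 a d had (key a ha) (key d hd)
  have ne1 : a ≠ b := by
    rintro rfl
    rw [hac] at hbc
    exact not_nonempty_empty hbc
  have ne2 : a ≠ d := by
    rintro rfl
    rw [inter_self] at had
    rw [had, empty_inter] at hab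
    exact not_nonempty_empty hab
  have ne3 : c ≠ d := by
    rintro rfl
    rw [hbd] at hbc
    exact not_nonempty_empty hbc
  clear ha hb hc hd hab hbc hcd hac had hbd key k2
  grind

/-- For `n ≥ 9`, the Turán number is `C(n-1,2) + 1`, uniquely attained by the starplus. -/
theorem turan_P4 (n : ℕ) (hn : 9 ≤ n) :
    (∀ V : Finset ℕ, ∀ H : Finset (Finset ℕ),
        V.card = n → ThreeGraphOn V H → P4Free H →
        H.card ≤ (n - 1).choose 2 + 1) ∧
    (∀ V : Finset ℕ, V.card = n →
        ∃ H : Finset (Finset ℕ), ThreeGraphOn V H ∧ P4Free H ∧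
          H.card = (n - 1).choose 2 + 1) ∧
    (∀ V : Finset ℕ, ∀ H : Finset (Finset ℕ),
        V.card = n → ThreeGraphOn V H → P4Free H →
        H.card = (n - 1).choose 2 + 1 → IsStarPlusOn V H) := by
  refine ⟨bd_all n hn, ?_, ?_⟩
  · intro V hc
    have hne : V.Nonempty := by
      rw [← card_pos]
      omega
    obtain ⟨v, hv⟩ := hne
    have h8 : 3 ≤ (V.erase v).card := by
      rw [card_erase_of_mem hv]
      omega
    obtain ⟨e, he, he3⟩ := exists_subset_card_eq h8
    have hve : v ∉ e := fun h => (mem_erase.1 (he h)).1 rfl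
    refine ⟨_, ?_, starplus_free (V := V) (v := v) (e := e), ?_⟩
    · intro x hx
      rw [mem_union, mem_singleton, mem_filter, mem_powersetCard] at hx
      rcases hx with hx | rfl
      · exact hx.1
      · exact ⟨he.trans (erase_subset _ _), he3⟩
    · rw [starplus_card hv hve, hc]
  · intro V H hc hV free hH
    subst hc
    rcases dich_of hV free hn (fun m h9 _ => bd_all m h9) with h | ⟨w, hw, a, ha, ha3, hwa, h⟩
    · omega
    · refine ⟨w, hw, a, ha, ha3, hwa, eq_of_subset_of_card_le (dich_sub hV h) ?_⟩
      rw [starplus_card hw hwa, hH]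
end

section
/- The Turán number ex₃(7;𝒫₄) equals 20, and the unique (up to isomorphism) 𝒫₄-free 3-graph on 7 vertices with 20 edges is the disjoint union of the complete 3-graph K₆^{(3)} on 6 vertices and one isolated vertex. -/
open Finset

/-- Boolean branching, directly on the recursor (cheap to evaluate in the kernel). -/
abbrev ifM {α : Type} (b : Bool) (x y : α) : α := Bool.rec (motive := fun _ => α) y x b

/-- Pick a clause whose restriction to `free` is as small as possible. -/
def selM (free : ℕ) (l : List ℕ) : ℕ → ℕ → ℕ :=
  List.rec (motive := fun _ => ℕ → ℕ → ℕ) (fun best _ => best)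
    (fun c _ ih best bs =>
      ifM (Nat.beq (Nat.land (Nat.land c free) (Nat.sub (Nat.land c free) 1)) 0)
        (Nat.land c free)
        (ifM (Nat.ble bs 2) (ih best bs)
          (ifM (Nat.beq (Nat.land (Nat.land (Nat.land c free) (Nat.sub (Nat.land c free) 1))
              (Nat.sub (Nat.land (Nat.land c free) (Nat.sub (Nat.land c free) 1)) 1)) 0)
            (ih (Nat.land c free) 2)
            (ifM (Nat.ble bs 3) (ih best bs) (ih (Nat.land c free) 3))))) l

/-- Greedy packing of disjoint clauses; `true` if more than `r` are found. -/
def packM (free : ℕ) (l : List ℕ) : ℕ → ℕ → Bool :=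
  List.rec (motive := fun _ => ℕ → ℕ → Bool) (fun _ _ => false)
    (fun c _ ih used r =>
      ifM (Nat.beq (Nat.land (Nat.land c free) used) 0)
        (ifM (Nat.beq r 0) true (ih (Nat.lor used c) (Nat.sub r 1)))
        (ih used r)) l

/-- Remove the clauses containing `bit`. -/
def rmM (bit : ℕ) (l : List ℕ) : List ℕ :=
  List.rec (motive := fun _ => List ℕ) []
    (fun c _ ih => ifM (Nat.beq (Nat.land c bit) 0) (c :: ih) ih) l

/-- Is some clause empty after restriction to `free`? -/
def zeroM (free : ℕ) (l : List ℕ) : Bool :=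
  List.rec (motive := fun _ => Bool) false
    (fun c _ ih => ifM (Nat.beq (Nat.land c free) 0) true ih) l

def starM (inm : ℕ) : Bool :=
  (List.range 7).any fun v => (List.range 7).all fun a => (List.range 7).all fun b =>
    a == b || a == v || b == v || inm.testBit (2 ^ v + 2 ^ a + 2 ^ b)

/-- One step of the branching, at the element `x`. -/
def stepM (k : ℕ → ℕ → List ℕ → ℕ → Bool) (free inm : ℕ) (l : List ℕ) (r bit : ℕ) : Bool :=
  ifM (k (Nat.xor free bit) (Nat.lor inm bit) (rmM bit l) (Nat.sub r 1))
    (k (Nat.xor free bit) inm l r) false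

/-- Branch and bound search for small hitting sets. -/
def checkM (n : ℕ) : ℕ → ℕ → List ℕ → ℕ → Bool :=
  Nat.rec (motive := fun _ => ℕ → ℕ → List ℕ → ℕ → Bool) (fun _ _ _ _ => false)
    (fun _ k free inm l r =>
      List.rec (motive := fun _ => Bool) (starM inm)
        (fun _ _ _ =>
          ifM (Nat.beq r 0) true
            (ifM (Nat.beq (selM free l 0 4) 0) (zeroM free l)
              (ifM (packM free l 0 r) true
                (stepM k free inm l r (Nat.pow 2 (Nat.log2 (selM free l 0 4))))))) l) n

def tM (a b c : ℕ) : ℕ := Nat.pow 2 (2 ^ a + 2 ^ b + 2 ^ c)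

def R7 : List ℕ := [0, 1, 2, 3, 4, 5, 6]

def clausesM : List ℕ :=
  R7.flatMap fun v => (R7.filter fun a => a != v).flatMap fun a =>
  (R7.filter fun b => Nat.blt a b && b != v).flatMap fun b =>
  (R7.filter fun d => Nat.blt a d && d != b && d != v).flatMap fun d =>
  (R7.filter fun e => Nat.blt d e && e != b && e != v).flatMap fun e =>
  (R7.filter fun c => c != a && c != b && c != d && c != e && c != v).flatMap fun c =>
  (R7.filter fun g => g != a && g != b && g != c && g != d && g != e && g != v).map fun g =>
  Nat.lor (Nat.lor (tM a b c) (tM d e g)) (Nat.lor (tM v a b) (tM v d e))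

def clausesU : List ℕ := tM 0 1 6 :: tM 0 2 6 :: tM 1 2 6 :: clausesM

def freeM : ℕ := 2 ^ 128 - 1 - 2 ^ 7 - 2 ^ 56

def pairsL : List (ℕ × ℕ × ℕ × ℕ × ℕ × ℕ) :=
  [(3, 5, 6, 0, 1, 2), (4, 5, 6, 0, 1, 3), (2, 4, 5, 0, 1, 6), (3, 4, 5, 0, 2, 6),
   (0, 3, 6, 1, 2, 4), (1, 4, 5, 0, 2, 3), (1, 2, 5, 3, 4, 6), (1, 3, 6, 0, 2, 4),
   (1, 5, 6, 0, 3, 4), (2, 5, 6, 0, 1, 4), (2, 3, 6, 0, 1, 5), (2, 3, 4, 0, 5, 6),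
   (1, 3, 4, 0, 2, 5), (1, 3, 5, 2, 4, 6), (0, 3, 5, 1, 2, 6), (1, 4, 6, 2, 3, 5)]

theorem ifM_eq {α : Type} (b : Bool) (x y : α) : ifM b x y = if b = true then x else y := by
  cases b <;> rfl

def Hit (S : Finset ℕ) (c : ℕ) : Prop := ∃ i ∈ S, c.testBit i = true

theorem packM_sound (S : Finset ℕ) (free : ℕ) (hS : ∀ i ∈ S, free.testBit i = true) :
    ∀ (l : List ℕ) (used r : ℕ), (∀ c ∈ l, Hit S c) → packM free l used r = true →
      r < (S.filter (fun i => used.testBit i = false)).card := by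
  intro l
  induction l with
  | nil => intro used r _ h; exact absurd h (by simp [packM])
  | cons c cs ih =>
    intro used r hl h
    have h' : ifM (Nat.beq (Nat.land (Nat.land c free) used) 0)
        (ifM (Nat.beq r 0) true (packM free cs (Nat.lor used c) (Nat.sub r 1)))
        (packM free cs used r) = true := h
    have hl' : ∀ c ∈ cs, Hit S c := fun d hd => hl d (List.mem_cons_of_mem _ hd)
    rw [ifM_eq, ifM_eq] at h'
    split_ifs at h' with h1 h2
    · obtain ⟨i, hi, hci⟩ := hl c List.mem_cons_self
      have h1' : (c &&& free) &&& used = 0 := Nat.eq_of_beq_eq_true h1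
      have h2' : r = 0 := Nat.eq_of_beq_eq_true h2
      have h3 : ((c &&& free) &&& used).testBit i = false := by rw [h1']; simp
      rw [Nat.testBit_and, Nat.testBit_and, hci, hS i hi] at h3
      subst h2'
      exact Finset.card_pos.2 ⟨i, by simp at h3; simp [hi, h3]⟩
    · obtain ⟨i, hi, hci⟩ := hl c List.mem_cons_self
      have h1' : (c &&& free) &&& used = 0 := Nat.eq_of_beq_eq_true h1
      have h3 : ((c &&& free) &&& used).testBit i = false := by rw [h1']; simp
      rw [Nat.testBit_and, Nat.testBit_and, hci, hS i hi] at h3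
      have h4 := ih _ _ hl' h'
      have hlt : (S.filter (fun i => (Nat.lor used c).testBit i = false)).card
          < (S.filter (fun i => used.testBit i = false)).card := by
        apply Finset.card_lt_card
        rw [Finset.ssubset_iff_of_subset]
        · refine ⟨i, by simp at h3; simp [hi, h3], ?_⟩
          have : (Nat.lor used c).testBit i = true := by
            change (used ||| c).testBit i = true
            rw [Nat.testBit_or, hci]; simp
          intro hm
          rw [Finset.mem_filter, this] at hm
          simp at hm
        · intro j hj
          rw [Finset.mem_filter] at hj ⊢
          refine ⟨hj.1, ?_⟩
          have h5 : (used ||| c).testBit j = false := hj.2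
          rw [Nat.testBit_or] at h5
          simp at h5; exact h5.1
      have h6 : r - 1 < _ := h4
      omega
    · exact ih _ _ hl' h'

theorem mem_rmM (bit : ℕ) (l : List ℕ) (c : ℕ) (h : c ∈ rmM bit l) :
    c ∈ l ∧ c &&& bit = 0 := by
  induction l with
  | nil => exact absurd h (by simp [rmM])
  | cons d cs ih =>
    have h' : c ∈ ifM (Nat.beq (Nat.land d bit) 0) (d :: rmM bit cs) (rmM bit cs) := h
    rw [ifM_eq] at h'
    split_ifs at h' with h1
    · rcases List.mem_cons.1 h' with rfl | h2
      · exact ⟨List.mem_cons_self, Nat.eq_of_beq_eq_true h1⟩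
      · exact ⟨List.mem_cons_of_mem _ (ih h2).1, (ih h2).2⟩
    · exact ⟨List.mem_cons_of_mem _ (ih h').1, (ih h').2⟩

theorem zeroM_sound (S : Finset ℕ) (free : ℕ) (hS : ∀ i ∈ S, free.testBit i = true)
    (l : List ℕ) (hl : ∀ c ∈ l, Hit S c) : zeroM free l ≠ true := by
  induction l with
  | nil => simp [zeroM]
  | cons c cs ih =>
    intro h
    have h' : ifM (Nat.beq (Nat.land c free) 0) true (zeroM free cs) = true := h
    rw [ifM_eq] at h'
    split_ifs at h' with h1
    · obtain ⟨i, hi, hci⟩ := hl c List.mem_cons_self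
      have h1' : c &&& free = 0 := Nat.eq_of_beq_eq_true h1
      have h3 : (c &&& free).testBit i = false := by rw [h1']; simp
      rw [Nat.testBit_and, hci, hS i hi] at h3
      simp at h3
    · exact ih (fun d hd => hl d (List.mem_cons_of_mem _ hd)) h'

def StarIn (S : Finset ℕ) (inm : ℕ) : Prop :=
  ∃ v < 7, ∀ a < 7, ∀ b < 7, a ≠ b → a ≠ v → b ≠ v →
    2 ^ v + 2 ^ a + 2 ^ b ∈ S ∨ inm.testBit (2 ^ v + 2 ^ a + 2 ^ b) = true

theorem starM_sound (S : Finset ℕ) (inm : ℕ) (h : starM inm = true) : StarIn S inm := by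
  unfold starM at h
  rw [List.any_eq_true] at h
  obtain ⟨v, hv, h⟩ := h
  refine ⟨v, List.mem_range.1 hv, fun a ha b hb hab hav hbv => Or.inr ?_⟩
  rw [List.all_eq_true] at h
  have h := h a (List.mem_range.2 ha)
  rw [List.all_eq_true] at h
  have h := h b (List.mem_range.2 hb)
  simpa [hab, hav, hbv] using h

theorem checkM_sound : ∀ (n : ℕ) (free inm : ℕ) (l : List ℕ) (r : ℕ) (S : Finset ℕ),
    (∀ i ∈ S, free.testBit i = true) → (∀ c ∈ l, Hit S c) → S.card ≤ r →
    checkM n free inm l r = true → StarIn S inm := by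
  intro n
  induction n with
  | zero => intro free inm l r S _ _ _ h; exact absurd h (by simp [checkM])
  | succ n ih =>
    intro free inm l r S hS hl hr h
    cases l with
    | nil => exact starM_sound S inm h
    | cons c cs =>
      have h' : ifM (Nat.beq r 0) true
            (ifM (Nat.beq (selM free (c :: cs) 0 4) 0) (zeroM free (c :: cs))
              (ifM (packM free (c :: cs) 0 r) true
                (stepM (checkM n) free inm (c :: cs) r
                  (Nat.pow 2 (Nat.log2 (selM free (c :: cs) 0 4)))))) = true := h
      rw [ifM_eq, ifM_eq, ifM_eq] at h'
      split_ifs at h' with h1 h2 h3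
      · obtain ⟨i, hi, -⟩ := hl c List.mem_cons_self
        have h1' : r = 0 := Nat.eq_of_beq_eq_true h1
        have := Finset.card_pos.2 ⟨i, hi⟩
        omega
      · exact absurd h' (zeroM_sound S free hS _ hl)
      · have := packM_sound S free hS _ _ _ hl h3
        have h4 := Finset.card_filter_le S (fun i => (0 : ℕ).testBit i = false)
        omega
      · generalize Nat.log2 (selM free (c :: cs) 0 4) = x at h'
        unfold stepM at h'
        rw [ifM_eq] at h'
        split_ifs at h' with h4
        have hfree : ∀ i, i ≠ x → free.testBit i = true →
            (Nat.xor free (Nat.pow 2 x)).testBit i = true := by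
          intro i hix hi
          change (free ^^^ 2 ^ x).testBit i = true
          rw [Nat.testBit_xor, hi, Nat.testBit_two_pow_of_ne (Ne.symm hix)]; rfl
        by_cases hx : x ∈ S
        · have := ih _ _ _ _ (S.erase x)
            (fun i hi => hfree i (Finset.ne_of_mem_erase hi) (hS i (Finset.mem_of_mem_erase hi)))
            (by
              intro d hd
              obtain ⟨hd1, hd2⟩ := mem_rmM _ _ _ hd
              obtain ⟨i, hi, hdi⟩ := hl d hd1
              refine ⟨i, Finset.mem_erase.2 ⟨?_, hi⟩, hdi⟩
              rintro rfl
              have h6 : (d &&& 2 ^ i).testBit i = false := by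
                have : d &&& 2 ^ i = 0 := hd2
                rw [this]; simp
              rw [Nat.testBit_and, hdi, Nat.testBit_two_pow_self] at h6
              simp at h6)
            (by
              rw [Finset.card_erase_of_mem hx]
              change S.card - 1 ≤ r - 1
              omega) h4
          obtain ⟨v, hv, H⟩ := this
          refine ⟨v, hv, fun a ha b hb hab hav hbv => ?_⟩
          rcases H a ha b hb hab hav hbv with h7 | h7
          · exact Or.inl (Finset.mem_of_mem_erase h7)
          · have h8 : (inm ||| 2 ^ x).testBit (2 ^ v + 2 ^ a + 2 ^ b) = true := h7
            rw [Nat.testBit_or, Bool.or_eq_true] at h8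
            rcases h8 with h8 | h8
            · exact Or.inr h8
            · left
              by_cases h9 : x = 2 ^ v + 2 ^ a + 2 ^ b
              · rwa [← h9]
              · rw [Nat.testBit_two_pow_of_ne h9] at h8
                simp at h8
        · exact ih _ _ _ _ S
            (fun i hi => hfree i (fun h => hx (h ▸ hi)) (hS i hi)) hl hr h'

theorem p4 {H : Finset (Finset ℕ)} (hP : P4Free H) {a b c d e h v : ℕ}
    (hn : [a, b, c, d, e, h, v].Nodup) :
    ({a, b, c} : Finset ℕ) ∉ H ∨ ({d, e, h} : Finset ℕ) ∉ H ∨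
      ({v, a, b} : Finset ℕ) ∉ H ∨ ({v, d, e} : Finset ℕ) ∉ H := by
  by_contra hcon
  push Not at hcon
  obtain ⟨h1, h2, h3, h4⟩ := hcon
  simp only [List.nodup_cons, List.mem_cons, not_or, List.not_mem_nil] at hn
  apply hP
  refine ⟨_, h1, _, h3, _, h4, _, h2, ⟨a, by simp⟩, ⟨v, by simp⟩, ⟨d, by simp⟩, ?_, ?_, ?_⟩ <;>
  · ext x
    simp only [Finset.mem_inter, Finset.mem_insert, Finset.mem_singleton, Finset.notMem_empty,
      iff_false]
    grind

theorem triple_card {x y z : ℕ} (h1 : x ≠ y) (h2 : x ≠ z) (h3 : y ≠ z) :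
    ({x, y, z} : Finset ℕ).card = 3 := Finset.card_eq_three.2 ⟨x, y, z, h1, h2, h3, rfl⟩

def encM (g : ℕ → ℕ) (e : Finset ℕ) : ℕ := ∑ i ∈ e.image g, 2 ^ i

def SM (g : ℕ → ℕ) (V : Finset ℕ) (H : Finset (Finset ℕ)) : Finset ℕ :=
  (V.powersetCard 3 \ H).image (encM g)

section
variable {f g : ℕ → ℕ} {V : Finset ℕ} {H : Finset (Finset ℕ)}

theorem f_ne (hfg : ∀ i < 7, g (f i) = i) {a b : ℕ} (ha : a < 7) (hb : b < 7) (hab : a ≠ b) :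
    f a ≠ f b := fun h => hab (by rw [← hfg a ha, ← hfg b hb, h])

theorem enc_triple (hfg : ∀ i < 7, g (f i) = i) {a b c : ℕ} (ha : a < 7) (hb : b < 7)
    (hc : c < 7) (hab : a ≠ b) (hac : a ≠ c) (hbc : b ≠ c) :
    encM g {f a, f b, f c} = 2 ^ a + 2 ^ b + 2 ^ c := by
  unfold encM
  rw [Finset.image_insert, Finset.image_insert, Finset.image_singleton, hfg a ha, hfg b hb,
    hfg c hc, Finset.sum_insert (by simp [hab, hac]), Finset.sum_insert (by simp [hbc]),
    Finset.sum_singleton]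
  ring

theorem mem_SM (hfg : ∀ i < 7, g (f i) = i) (hV : V = (range 7).image f)
    {a b c : ℕ} (ha : a < 7) (hb : b < 7)
    (hc : c < 7) (hab : a ≠ b) (hac : a ≠ c) (hbc : b ≠ c) :
    2 ^ a + 2 ^ b + 2 ^ c ∈ SM g V H ↔ ({f a, f b, f c} : Finset ℕ) ∉ H := by
  have hsub : ({f a, f b, f c} : Finset ℕ) ⊆ V := by
    rw [hV]
    intro x hx
    simp only [Finset.mem_insert, Finset.mem_singleton] at hx
    rw [Finset.mem_image]
    rcases hx with rfl | rfl | rfl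
    · exact ⟨a, by simpa using ha, rfl⟩
    · exact ⟨b, by simpa using hb, rfl⟩
    · exact ⟨c, by simpa using hc, rfl⟩
  have hfgV : ∀ e ⊆ V, (e.image g).image f = e := by
    intro e he
    rw [Finset.image_image]
    conv_rhs => rw [← Finset.image_id (s := e)]
    apply Finset.image_congr
    intro x hx
    have hx' := he hx
    rw [hV, Finset.mem_image] at hx'
    obtain ⟨i, hi, rfl⟩ := hx'
    simp [hfg i (by simpa using hi)]
  rw [← enc_triple hfg ha hb hc hab hac hbc]
  constructor
  · intro h
    unfold SM at h
    rw [Finset.mem_image] at h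
    obtain ⟨e, he, h⟩ := h
    rw [Finset.mem_sdiff, Finset.mem_powersetCard] at he
    have h2 := Finset.geomSum_injective (n := 2) le_rfl h
    have h3 : e = {f a, f b, f c} := by rw [← hfgV e he.1.1, h2, hfgV _ hsub]
    rw [← h3]; exact he.2
  · intro h
    exact Finset.mem_image_of_mem _ (Finset.mem_sdiff.2 ⟨Finset.mem_powersetCard.2 ⟨hsub,
      triple_card (f_ne hfg ha hb hab) (f_ne hfg ha hc hac) (f_ne hfg hb hc hbc)⟩, h⟩)

theorem SM_lt (hfg : ∀ i < 7, g (f i) = i) (hV : V = (range 7).image f) :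
    ∀ i ∈ SM g V H, i < 128 := by
  intro i hi
  unfold SM at hi
  rw [Finset.mem_image] at hi
  obtain ⟨e, he, rfl⟩ := hi
  rw [Finset.mem_sdiff, Finset.mem_powersetCard] at he
  have : encM g e < 2 ^ 7 := by
    apply Nat.geomSum_lt le_rfl
    intro k hk
    rw [Finset.mem_image] at hk
    obtain ⟨x, hx, rfl⟩ := hk
    have hx' := he.1.1 hx
    rw [hV, Finset.mem_image] at hx'
    obtain ⟨i, hi, rfl⟩ := hx'
    rw [hfg i (by simpa using hi)]
    simpa using hi
  simpa using this

theorem SM_card (hV7 : V.card = 7) (hH : ThreeGraphOn V H) (hc : 20 ≤ H.card) :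
    (SM g V H).card ≤ 15 := by
  refine Finset.card_image_le.trans ?_
  have hsub : H ⊆ V.powersetCard 3 := fun e he => Finset.mem_powersetCard.2 (hH e he)
  rw [Finset.card_sdiff_of_subset hsub, Finset.card_powersetCard, hV7]
  have : Nat.choose 7 3 = 35 := by decide
  omega

end

theorem tM_testBit (a b c : ℕ) : (tM a b c).testBit (2 ^ a + 2 ^ b + 2 ^ c) = true :=
  Nat.testBit_two_pow_self

def pairClauses : List ℕ :=
  pairsL.map fun p => Nat.lor (tM p.1 p.2.1 p.2.2.1) (tM p.2.2.2.1 p.2.2.2.2.1 p.2.2.2.2.2)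

theorem pairs_pack : packM (2 ^ 128 - 1) pairClauses 0 15 = true := by decide +kernel

theorem pairs_ok : ∀ p ∈ pairsL, p.1 < 7 ∧ p.2.1 < 7 ∧ p.2.2.1 < 7 ∧ p.2.2.2.1 < 7 ∧
    p.2.2.2.2.1 < 7 ∧ p.2.2.2.2.2 < 7 ∧
    [p.1, p.2.1, p.2.2.1, p.2.2.2.1, p.2.2.2.2.1, p.2.2.2.2.2].Nodup := by decide +kernel

theorem lor_hit {S : Finset ℕ} {x y : ℕ} (h : Hit S x ∨ Hit S y) : Hit S (Nat.lor x y) := by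
  rcases h with ⟨i, hi, h⟩ | ⟨i, hi, h⟩
  · exact ⟨i, hi, by change (x ||| y).testBit i = true; rw [Nat.testBit_or, h]; rfl⟩
  · exact ⟨i, hi, by change (x ||| y).testBit i = true; rw [Nat.testBit_or, h]; simp⟩

theorem exists_pair {f g : ℕ → ℕ} {V : Finset ℕ} {H : Finset (Finset ℕ)}
    (hfg : ∀ i < 7, g (f i) = i) (hV : V = (range 7).image f) (hV7 : V.card = 7)
    (hH : ThreeGraphOn V H) (hc : 20 ≤ H.card) :
    ∃ A ∈ H, ∃ B ∈ H, Disjoint A B := by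
  by_contra hcon
  push Not at hcon
  have hlt := SM_lt (H := H) hfg hV
  have hfree : ∀ i ∈ SM g V H, (2 ^ 128 - 1 : ℕ).testBit i = true := by
    intro i hi
    rw [Nat.testBit_two_pow_sub_one]
    simpa using hlt i hi
  have := packM_sound (SM g V H) (2 ^ 128 - 1) hfree pairClauses 0 15 ?_ pairs_pack
  · have h4 := Finset.card_filter_le (SM g V H) (fun i => (0 : ℕ).testBit i = false)
    have := SM_card (g := g) hV7 hH hc
    omega
  · intro c hc
    unfold pairClauses at hc
    rw [List.mem_map] at hc
    obtain ⟨⟨a, b, c, d, e, h⟩, hp, rfl⟩ := hc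
    obtain ⟨ha, hb, hc, hd, he, hh, hn⟩ := pairs_ok _ hp
    simp only [List.nodup_cons, List.mem_cons, not_or, List.not_mem_nil] at ha hb hc hd he hh hn
    apply lor_hit
    by_cases h1 : ({f a, f b, f c} : Finset ℕ) ∈ H
    · by_cases h2 : ({f d, f e, f h} : Finset ℕ) ∈ H
      · refine absurd ?_ (hcon _ h1 _ h2)
        have hne := @f_ne f g hfg
        rw [Finset.disjoint_left]
        intro x hx hy
        simp only [Finset.mem_insert, Finset.mem_singleton] at hx hy
        rcases hx with rfl | rfl | rfl <;> rcases hy with hy | hy | hy <;>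
          exact hne (by assumption) (by assumption) (by grind) hy
      · exact Or.inr ⟨_, (mem_SM hfg hV hd he hh (by grind) (by grind) (by grind)).2 h2,
          tM_testBit _ _ _⟩
    · exact Or.inl ⟨_, (mem_SM hfg hV ha hb hc (by grind) (by grind) (by grind)).2 h1,
          tM_testBit _ _ _⟩

set_option maxRecDepth 100000 in
theorem check_ok : checkM 60 freeM 0 clausesU 15 = true := by decide +kernel

theorem freeM_testBit : ∀ i < 128, i ≠ 7 → i ≠ 56 → freeM.testBit i = true := by decide +kernel

theorem mem_R7 {a : ℕ} (h : a ∈ R7) : a < 7 := by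
  simp only [R7, List.mem_cons, List.not_mem_nil, or_false] at h
  omega

theorem mem_clausesM {x : ℕ} (h : x ∈ clausesM) : ∃ a b c d e h v : ℕ,
    a < 7 ∧ b < 7 ∧ c < 7 ∧ d < 7 ∧ e < 7 ∧ h < 7 ∧ v < 7 ∧ [a, b, c, d, e, h, v].Nodup ∧
    x = Nat.lor (Nat.lor (tM a b c) (tM d e h)) (Nat.lor (tM v a b) (tM v d e)) := by
  simp only [clausesM, List.mem_flatMap, List.mem_filter, List.mem_map, Bool.and_eq_true,
    bne_iff_ne, Nat.blt_eq] at h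
  obtain ⟨v, hv, a, ⟨ha, ha'⟩, b, ⟨hb, hb'⟩, d, ⟨hd, hd'⟩, e, ⟨he, he'⟩, c, ⟨hc, hc'⟩, h,
    ⟨hh, hh'⟩, rfl⟩ := h
  refine ⟨a, b, c, d, e, h, v, mem_R7 ha, mem_R7 hb, mem_R7 hc, mem_R7 hd, mem_R7 he, mem_R7 hh,
    mem_R7 hv, ?_, rfl⟩
  grind

theorem isolated {f g : ℕ → ℕ} {V : Finset ℕ} {H : Finset (Finset ℕ)}
    (hfg : ∀ i < 7, g (f i) = i) (hV : V = (range 7).image f) (hV7 : V.card = 7)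
    (hH : ThreeGraphOn V H) (hP : P4Free H) (hc : 20 ≤ H.card)
    (hA : ({f 0, f 1, f 2} : Finset ℕ) ∈ H) (hB : ({f 3, f 4, f 5} : Finset ℕ) ∈ H)
    (h1 : ({f 0, f 1, f 6} : Finset ℕ) ∉ H) (h2 : ({f 0, f 2, f 6} : Finset ℕ) ∉ H)
    (h3 : ({f 1, f 2, f 6} : Finset ℕ) ∉ H) :
    ∃ x ∈ V, ∀ e ∈ H, x ∉ e := by
  have hmem := @mem_SM f g V H hfg hV
  have key : StarIn (SM g V H) 0 := by
    refine checkM_sound 60 freeM 0 clausesU 15 (SM g V H) ?_ ?_ (SM_card hV7 hH hc) check_ok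
    · intro i hi
      refine freeM_testBit i (SM_lt hfg hV i hi) ?_ ?_
      · rintro rfl
        exact (hmem (a := 0) (b := 1) (c := 2) (by omega) (by omega) (by omega) (by omega)
          (by omega) (by omega)).1 hi hA
      · rintro rfl
        exact (hmem (a := 3) (b := 4) (c := 5) (by omega) (by omega) (by omega) (by omega)
          (by omega) (by omega)).1 hi hB
    · have hit : ∀ a b c : ℕ, a < 7 → b < 7 → c < 7 → a ≠ b → a ≠ c → b ≠ c →
          ({f a, f b, f c} : Finset ℕ) ∉ H → Hit (SM g V H) (tM a b c) :=
        fun a b c ha hb hc hab hac hbc h =>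
          ⟨_, (hmem ha hb hc hab hac hbc).2 h, tM_testBit _ _ _⟩
      intro x hx
      simp only [clausesU, List.mem_cons] at hx
      rcases hx with rfl | rfl | rfl | hx
      · exact hit _ _ _ (by omega) (by omega) (by omega) (by omega) (by omega) (by omega) h1
      · exact hit _ _ _ (by omega) (by omega) (by omega) (by omega) (by omega) (by omega) h2
      · exact hit _ _ _ (by omega) (by omega) (by omega) (by omega) (by omega) (by omega) h3
      · obtain ⟨a, b, c, d, e, h, v, ha, hb, hc, hd, he, hh, hv, hn, rfl⟩ := mem_clausesM hx
        have hn' : [f a, f b, f c, f d, f e, f h, f v].Nodup := by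
          change ([a, b, c, d, e, h, v].map f).Nodup
          refine List.Nodup.map_on ?_ hn
          intro x hx y hy hxy
          by_contra hne
          simp only [List.mem_cons, List.not_mem_nil, or_false] at hx hy
          exact f_ne hfg (by rcases hx with rfl | rfl | rfl | rfl | rfl | rfl | rfl <;> assumption)
            (by rcases hy with rfl | rfl | rfl | rfl | rfl | rfl | rfl <;> assumption) hne hxy
        simp only [List.nodup_cons, List.mem_cons, not_or, List.not_mem_nil] at hn
        rcases p4 hP hn' with h4 | h4 | h4 | h4
        · exact lor_hit (Or.inl (lor_hit (Or.inl (hit _ _ _ (by assumption) (by assumption)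
            (by assumption) (by grind) (by grind) (by grind) h4))))
        · exact lor_hit (Or.inl (lor_hit (Or.inr (hit _ _ _ (by assumption) (by assumption)
            (by assumption) (by grind) (by grind) (by grind) h4))))
        · exact lor_hit (Or.inr (lor_hit (Or.inl (hit _ _ _ (by assumption) (by assumption)
            (by assumption) (by grind) (by grind) (by grind) h4))))
        · exact lor_hit (Or.inr (lor_hit (Or.inr (hit _ _ _ (by assumption) (by assumption)
            (by assumption) (by grind) (by grind) (by grind) h4))))
  obtain ⟨v, hv, key⟩ := key
  refine ⟨f v, by rw [hV]; exact Finset.mem_image_of_mem _ (by simpa using hv), ?_⟩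
  intro e he hve
  obtain ⟨heV, he3⟩ := hH e he
  have hcard : (e.erase (f v)).card = 2 := by rw [Finset.card_erase_of_mem hve, he3]
  obtain ⟨x, y, hxy, hexy⟩ := Finset.card_eq_two.1 hcard
  have hx : x ∈ e.erase (f v) := by rw [hexy]; simp
  have hy : y ∈ e.erase (f v) := by rw [hexy]; simp
  have hx' := heV (Finset.mem_of_mem_erase hx)
  have hy' := heV (Finset.mem_of_mem_erase hy)
  rw [hV, Finset.mem_image] at hx' hy'
  obtain ⟨a, ha, rfl⟩ := hx'
  obtain ⟨b, hb, rfl⟩ := hy'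
  have ha := Finset.mem_range.1 ha
  have hb := Finset.mem_range.1 hb
  have hab : a ≠ b := fun h => hxy (by rw [h])
  have hav : a ≠ v := fun h => Finset.ne_of_mem_erase hx (by rw [h])
  have hbv : b ≠ v := fun h => Finset.ne_of_mem_erase hy (by rw [h])
  have hee : e = {f v, f a, f b} := by
    rw [← Finset.insert_erase hve, hexy]
  rcases key a ha b hb hab hav hbv with h5 | h5
  · exact (hmem hv ha hb (Ne.symm hav) (Ne.symm hbv) hab).1 h5 (hee ▸ he)
  · simp at h5

theorem exists_labels (l : List ℕ) (hn : l.Nodup) (hl : l.length = 7) :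
    (∀ i < 7, l.idxOf (l.getD i 0) = i) ∧ l.toFinset = (range 7).image (fun i => l.getD i 0) := by
  constructor
  · intro i hi
    rw [List.getD_eq_getElem _ _ (by omega)]
    exact hn.idxOf_getElem i (by omega)
  · ext x
    rw [List.mem_toFinset, Finset.mem_image, List.mem_iff_getElem]
    constructor
    · rintro ⟨i, hi, rfl⟩
      exact ⟨i, by simp; omega, List.getD_eq_getElem _ _ hi⟩
    · rintro ⟨i, hi, rfl⟩
      have hi := Finset.mem_range.1 hi
      exact ⟨i, by omega, (List.getD_eq_getElem _ _ (by omega)).symm⟩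

theorem isolated_of_labels {V : Finset ℕ} {H : Finset (Finset ℕ)} {a b c d e h v : ℕ}
    (hn : [a, b, c, d, e, h, v].Nodup) (hV : V = [a, b, c, d, e, h, v].toFinset)
    (hH : ThreeGraphOn V H) (hP : P4Free H) (hc : 20 ≤ H.card)
    (hA : ({a, b, c} : Finset ℕ) ∈ H) (hB : ({d, e, h} : Finset ℕ) ∈ H)
    (h1 : ({a, b, v} : Finset ℕ) ∉ H) (h2 : ({a, c, v} : Finset ℕ) ∉ H)
    (h3 : ({b, c, v} : Finset ℕ) ∉ H) :
    ∃ x ∈ V, ∀ e ∈ H, x ∉ e := by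
  obtain ⟨hfg, himg⟩ := exists_labels _ hn rfl
  have hV7 : V.card = 7 := by rw [hV, List.toFinset_card_of_nodup hn]; rfl
  exact isolated (f := fun i => [a, b, c, d, e, h, v].getD i 0)
    (g := fun x => [a, b, c, d, e, h, v].idxOf x) hfg (hV.trans himg) hV7 hH hP hc hA hB h1 h2 h3

theorem tri_cyc (x y z : ℕ) : ({x, y, z} : Finset ℕ) = {z, x, y} := by
  ext w; simp only [Finset.mem_insert, Finset.mem_singleton]; tauto

theorem tri_swap (x y z : ℕ) : ({x, y, z} : Finset ℕ) = {x, z, y} := by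
  ext w; simp only [Finset.mem_insert, Finset.mem_singleton]; tauto

theorem union_seven (a b c d e h v : ℕ) :
    ({a, b, c} ∪ {d, e, h} ∪ {v} : Finset ℕ) = [a, b, c, d, e, h, v].toFinset := by
  ext w
  simp only [Finset.mem_union, Finset.mem_insert, Finset.mem_singleton, List.mem_toFinset,
    List.mem_cons, List.not_mem_nil, or_false, or_assoc]

theorem union_seven2 (a b c d e h v : ℕ) :
    ({a, b, c} ∪ {d, e, h} ∪ {v} : Finset ℕ) = [d, e, h, a, b, c, v].toFinset := by
  rw [Finset.union_comm {a, b, c} {d, e, h}, union_seven]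

theorem exists_isolated {V : Finset ℕ} {H : Finset (Finset ℕ)} (hV7 : V.card = 7)
    (hH : ThreeGraphOn V H) (hP : P4Free H) (hc : 20 ≤ H.card) :
    ∃ x ∈ V, ∀ e ∈ H, x ∉ e := by
  obtain ⟨hfg, himg⟩ := exists_labels V.toList V.nodup_toList (by simpa using hV7)
  rw [Finset.toList_toFinset] at himg
  obtain ⟨A, hA, B, hB, hAB⟩ := exists_pair (f := fun i => V.toList.getD i 0)
    (g := fun x => V.toList.idxOf x) hfg himg hV7 hH hc
  obtain ⟨hAV, hA3⟩ := hH A hA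
  obtain ⟨hBV, hB3⟩ := hH B hB
  have hU : (A ∪ B).card = 6 := by rw [Finset.card_union_of_disjoint hAB, hA3, hB3]
  have hUV : A ∪ B ⊆ V := Finset.union_subset hAV hBV
  have hD : (V \ (A ∪ B)).card = 1 := by
    rw [Finset.card_sdiff_of_subset hUV, hV7, hU]
  obtain ⟨v, hv⟩ := Finset.card_eq_one.1 hD
  have hvm : v ∈ V \ (A ∪ B) := by rw [hv]; simp
  have hVeq : V = A ∪ B ∪ {v} := by rw [← hv, Finset.union_sdiff_of_subset hUV]
  obtain ⟨a, b, c, hab, hac, hbc, rfl⟩ := Finset.card_eq_three.1 hA3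
  obtain ⟨d, e, h, hde, hdh, heh, rfl⟩ := Finset.card_eq_three.1 hB3
  have hn : [a, b, c, d, e, h, v].Nodup := by
    simp only [Finset.mem_sdiff, Finset.mem_union, Finset.mem_insert, Finset.mem_singleton,
      not_or] at hvm
    simp only [Finset.disjoint_left, Finset.mem_insert, Finset.mem_singleton, not_or,
      forall_eq_or_imp, forall_eq] at hAB
    simp only [List.nodup_cons, List.mem_cons, not_or, List.not_mem_nil, List.nodup_nil,
          not_false_eq_true, and_true]; grind only
  by_cases hs : ({a, b, v} : Finset ℕ) ∉ H ∧ ({a, c, v} : Finset ℕ) ∉ H ∧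
      ({b, c, v} : Finset ℕ) ∉ H
  · refine isolated_of_labels hn ?_ hH hP hc hA hB hs.1 hs.2.1 hs.2.2
    rw [hVeq]; exact union_seven _ _ _ _ _ _ _
  · have hcyc := tri_cyc
    have hsw := tri_swap
    have hn0 := hn
    simp only [List.nodup_cons, List.mem_cons, not_or, List.not_mem_nil, List.nodup_nil,
      not_false_eq_true, and_true] at hn0
    obtain ⟨p, q, r, hpqr, hpq, hpn⟩ : ∃ p q r : ℕ, ({a, b, c} : Finset ℕ) = {p, q, r} ∧
        ({v, p, q} : Finset ℕ) ∈ H ∧ [p, q, r, d, e, h, v].Nodup := by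
      have hd : ({a, b, v} : Finset ℕ) ∈ H ∨ ({a, c, v} : Finset ℕ) ∈ H ∨
          ({b, c, v} : Finset ℕ) ∈ H := by tauto
      rcases hd with h1 | h1 | h1
      · exact ⟨a, b, c, rfl, by rwa [← hcyc], hn⟩
      · refine ⟨a, c, b, hsw _ _ _, by rwa [← hcyc], ?_⟩
        simp only [List.nodup_cons, List.mem_cons, not_or, List.not_mem_nil, List.nodup_nil,
          not_false_eq_true, and_true]; grind only
      · refine ⟨b, c, a, (hcyc _ _ _).symm, by rwa [← hcyc], ?_⟩
        simp only [List.nodup_cons, List.mem_cons, not_or, List.not_mem_nil, List.nodup_nil,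
          not_false_eq_true, and_true]; grind only
    have hpn0 := hpn
    simp only [List.nodup_cons, List.mem_cons, not_or, List.not_mem_nil, List.nodup_nil,
      not_false_eq_true, and_true] at hpn0
    have hA' : ({p, q, r} : Finset ℕ) ∈ H := hpqr ▸ hA
    have side : ∀ x y z : ℕ, ({x, y, z} : Finset ℕ) ∈ H → [p, q, r, x, y, z, v].Nodup →
        ({x, y, v} : Finset ℕ) ∉ H := by
      intro x y z hxyz hnn hcon
      rcases p4 hP hnn with h4 | h4 | h4 | h4
      · exact h4 hA'
      · exact h4 hxyz
      · exact h4 hpq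
      · rw [hcyc] at hcon; exact h4 hcon
    have s1 := side d e h hB hpn
    have s2 := side d h e (hsw d e h ▸ hB) (by
      simp only [List.nodup_cons, List.mem_cons, not_or, List.not_mem_nil, List.nodup_nil,
          not_false_eq_true, and_true]; grind only)
    have s3 := side e h d (hcyc e h d ▸ hB) (by
      simp only [List.nodup_cons, List.mem_cons, not_or, List.not_mem_nil, List.nodup_nil,
          not_false_eq_true, and_true]; grind only)
    refine isolated_of_labels (a := d) (b := e) (c := h) (d := a) (e := b) (h := c) (v := v)
      ?_ ?_ hH hP hc hB hA s1 s2 s3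
    · simp only [List.nodup_cons, List.mem_cons, not_or, List.not_mem_nil, List.nodup_nil,
          not_false_eq_true, and_true]; grind only
    · rw [hVeq]; exact union_seven2 _ _ _ _ _ _ _

theorem sub_K6 {V : Finset ℕ} {H : Finset (Finset ℕ)} (hV7 : V.card = 7)
    (hH : ThreeGraphOn V H) (hP : P4Free H) (hc : 20 ≤ H.card) :
    ∃ W ⊆ V, W.card = 6 ∧ H = W.powersetCard 3 := by
  obtain ⟨x, hx, hiso⟩ := exists_isolated hV7 hH hP hc
  have hW : (V.erase x).card = 6 := by rw [Finset.card_erase_of_mem hx, hV7]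
  refine ⟨V.erase x, Finset.erase_subset _ _, hW, ?_⟩
  apply Finset.eq_of_subset_of_card_le
  · intro e he
    rw [Finset.mem_powersetCard]
    exact ⟨fun y hy => Finset.mem_erase.2 ⟨fun h => hiso e he (h ▸ hy), (hH e he).1 hy⟩,
      (hH e he).2⟩
  · rw [Finset.card_powersetCard, hW]
    exact hc

theorem card_K6 {W : Finset ℕ} (hW : W.card = 6) : (W.powersetCard 3).card = 20 := by
  rw [Finset.card_powersetCard, hW]; rfl

theorem K6_free {W : Finset ℕ} (hW : W.card = 6) : P4Free (W.powersetCard 3) := by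
  rintro ⟨a, ha, b, hb, c, hc, d, hd, h1, h2, h3, h4, h5, h6⟩
  rw [Finset.mem_powersetCard] at ha hb hc hd
  rw [← Finset.disjoint_iff_inter_eq_empty] at h4 h5 h6
  have hU : a ∪ d = W := by
    apply Finset.eq_of_subset_of_card_le (Finset.union_subset ha.1 hd.1)
    rw [Finset.card_union_of_disjoint h5, ha.2, hd.2, hW]
  have hb' : b ⊆ a := by
    intro x hx
    have : x ∈ a ∪ d := hU ▸ hb.1 hx
    rcases Finset.mem_union.1 this with h | h
    · exact h
    · exact absurd h (Finset.disjoint_left.1 h6 hx)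
  obtain ⟨x, hx⟩ := h2
  rw [Finset.mem_inter] at hx
  exact Finset.disjoint_left.1 h4 (hb' hx.1) hx.2

/-- `ex₃(7; 𝒫₄) = 20` and the unique extremal 3-graph on 7 vertices is
`K₆⁽³⁾` (the complete 3-graph on some 6 of the 7 vertices) together with one
isolated vertex. -/
theorem turan_P4_seven :
    (∀ V : Finset ℕ, ∀ H : Finset (Finset ℕ),
        V.card = 7 → ThreeGraphOn V H → P4Free H → H.card ≤ 20) ∧
    (∀ V : Finset ℕ, V.card = 7 →
        ∃ H : Finset (Finset ℕ), ThreeGraphOn V H ∧ P4Free H ∧ H.card = 20) ∧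
    (∀ V : Finset ℕ, ∀ H : Finset (Finset ℕ),
        V.card = 7 → ThreeGraphOn V H → P4Free H → H.card = 20 →
        ∃ W ⊆ V, W.card = 6 ∧ H = W.powersetCard 3) := by
  refine ⟨?_, ?_, ?_⟩
  · intro V H hV hH hP
    by_contra hcon
    obtain ⟨W, -, hW, rfl⟩ := sub_K6 hV hH hP (by omega)
    exact hcon (card_K6 hW).le
  · intro V hV
    obtain ⟨W, hWV, hW⟩ := Finset.exists_subset_card_eq (s := V) (n := 6) (by omega)
    exact ⟨W.powersetCard 3, fun e he => ⟨(Finset.mem_powersetCard.1 he).1.trans hWV,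
      (Finset.mem_powersetCard.1 he).2⟩, K6_free hW, card_K6 hW⟩
  · intro V H hV hH hP hc
    exact sub_K6 hV hH hP hc.ge
end
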